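/- arXiv:2603.26614 — 8 statements merged into one kernel-verified Lean document; each statement's English description precedes it below -/
import Mathlib

section
/- Let m ≥ 1 and let v ∈ R^m be a nonzero vector with v ∈ pR^m (i.e., v is not a root word). Then the orthogonal module O(v) = {x ∈ R^m : v·x = 0} is not a free R-module, and every generating set of O(v) as an R-module has at least m elements. -/
/-- The standard bilinear form (dot product) on `Fin m → R`. -/
def dot {R : Type*} [CommRing R] {m : ℕ} (v w : Fin m → R) : R := ∑ i, v i * w i

/-- The dot product with a fixed vector, as a linear map. -/
def dotLin {R : Type*} [CommRing R] {m : ℕ} (v : Fin m → R) : (Fin m → R) →ₗ[R] R where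
  toFun x := dot v x
  map_add' x y := by simp [dot, mul_add, Finset.sum_add_distrib]
  map_smul' c x := by simp [dot, Finset.mul_sum, smul_eq_mul, mul_left_comm]

/-- The orthogonal module `O(v) = {x : v·x = 0}`. -/
def orth {R : Type*} [CommRing R] {m : ℕ} (v : Fin m → R) : Submodule R (Fin m → R) :=
  LinearMap.ker (dotLin v)

/-- Evaluation (generator-matrix) linear map attached to a family `Λ`. -/
def evalMap {R : Type*} [CommRing R] {m : ℕ} {ι : Type*} (Λ : ι → Fin m → R) :
    (Fin m → R) →ₗ[R] (ι → R) where
  toFun v i := dot v (Λ i)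
  map_add' v w := by funext i; simp [dot, add_mul, Finset.sum_add_distrib]
  map_smul' c v := by funext i; simp [dot, Finset.mul_sum, smul_eq_mul, mul_assoc]

/-- The linear code attached to the family `Λ`. -/
def code {R : Type*} [CommRing R] {m : ℕ} {ι : Type*} (Λ : ι → Fin m → R) :
    Set (ι → R) := Set.range (evalMap Λ)

/-- `c` is a minimal codeword of the code `C`. -/
def IsMinimalWord {R : Type*} [CommRing R] {ι : Type*} (C : Set (ι → R)) (c : ι → R) : Prop :=
  c ≠ 0 ∧ ∀ c' ∈ C, (∀ i, c' i ≠ 0 → c i ≠ 0) → ∃ a : R, c' = a • c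

/-- `C` is a minimal linear code: all its nonzero codewords are minimal. -/
def IsMinimalCode {R : Type*} [CommRing R] {ι : Type*} (C : Set (ι → R)) : Prop :=
  ∀ c ∈ C, c ≠ 0 → IsMinimalWord C c

/-- Hamming weight. -/
noncomputable def wt {R : Type*} [Zero R] {m : ℕ} (x : Fin m → R) : ℕ := {i | x i ≠ 0}.ncard

/-- The submodule `M(v,Λ)` generated by those members of `Λ` orthogonal to `v`. -/
def MvLam {R : Type*} [CommRing R] {m : ℕ} {ι : Type*} (Λ : ι → Fin m → R) (v : Fin m → R) :
    Submodule R (Fin m → R) :=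
  Submodule.span R {α | ∃ i, α = Λ i ∧ dot v (Λ i) = 0}

/-- Codeword of the function-based code `C_f`. -/
def cword {R : Type*} [CommRing R] {m : ℕ} (f : (Fin m → R) → R) (a : R) (v : Fin m → R) :
    {x : Fin m → R // x ≠ 0} → R := fun x => a * f x.1 + dot v x.1

/-- The function-based code `C_f`. -/
def Cf {R : Type*} [CommRing R] {m : ℕ} (f : (Fin m → R) → R) :
    Set ({x : Fin m → R // x ≠ 0} → R) := {c | ∃ a v, c = cword f a v}

/-- Multiplication by `p` on a finite group: the kernel has as many elements as the cokernel. -/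
theorem aux_card_ker {A : Type*} [AddCommGroup A] [Finite A] (p : ℕ) :
    Nat.card (nsmulAddMonoidHom (α := A) p).ker = (nsmulAddMonoidHom (α := A) p).range.index := by
  have h1 := (nsmulAddMonoidHom (α := A) p).ker.card_mul_index
  have h2 := (nsmulAddMonoidHom (α := A) p).range.card_mul_index
  rw [AddSubgroup.index_ker, ← h2, mul_comm] at h1
  exact Nat.eq_of_mul_eq_mul_left Nat.card_pos h1

theorem aux_card_le {A B : Type*} [AddCommGroup A] [Finite A] [AddCommGroup B] [Finite B] (p : ℕ)
    (f : A →+ B) (hf : Function.Surjective f) :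
    Nat.card (nsmulAddMonoidHom (α := B) p).ker ≤ Nat.card (nsmulAddMonoidHom (α := A) p).ker := by
  rw [aux_card_ker, aux_card_ker, ← AddSubgroup.index_comap_of_surjective _ hf]
  apply Nat.le_of_dvd
  · exact Nat.pos_of_ne_zero AddSubgroup.index_ne_zero_of_finite
  · apply AddSubgroup.index_dvd_of_le
    rintro _ ⟨a, rfl⟩
    exact ⟨f a, by simp⟩

theorem aux_card_pi {R ι : Type*} [AddCommGroup R] [Fintype ι] (p : ℕ) :
    Nat.card (nsmulAddMonoidHom (α := ι → R) p).ker
      = Nat.card (nsmulAddMonoidHom (α := R) p).ker ^ Fintype.card ι := by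
  have e : (nsmulAddMonoidHom (α := ι → R) p).ker ≃ (ι → (nsmulAddMonoidHom (α := R) p).ker) :=
    { toFun := fun x i => ⟨x.1 i, by
        have h := x.2
        rw [AddMonoidHom.mem_ker] at h ⊢
        exact congrFun h i⟩
      invFun := fun y => ⟨fun i => (y i).1, by
        rw [AddMonoidHom.mem_ker]
        funext i
        exact (y i).2⟩
      left_inv := fun x => rfl
      right_inv := fun y => rfl }
  rw [Nat.card_congr e, Nat.card_fun, Nat.card_eq_fintype_card (α := ι)]

theorem aux_card_inj {A B : Type*} [AddCommGroup A] [AddCommGroup B] [Finite B] (p : ℕ)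
    (f : A → B) (hf : Function.Injective f) (h : ∀ x, p • x = 0 → p • f x = 0) :
    Nat.card (nsmulAddMonoidHom (α := A) p).ker ≤ Nat.card (nsmulAddMonoidHom (α := B) p).ker := by
  refine Nat.card_le_card_of_injective (fun x => ⟨f x.1, h x.1 x.2⟩) ?_
  intro x y hxy
  exact Subtype.ext (hf (congrArg Subtype.val hxy))

theorem stmt_1
    (R : Type) [CommRing R] [IsLocalRing R] [Fintype R]
    (p n ℓ : ℕ) (hp : p.Prime) (hn : 1 ≤ n)
    (hmax : IsLocalRing.maximalIdeal R = Ideal.span {(p : R)})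
    (hpn : (p : R) ^ n = 0) (hpn1 : (p : R) ^ (n - 1) ≠ 0)
    (hres : Nat.card (IsLocalRing.ResidueField R) = p ^ ℓ)
    (m : ℕ) (hm : 1 ≤ m) (v : Fin m → R) (hv : v ≠ 0)
    (hnotroot : ∃ w : Fin m → R, v = (p : R) • w) :
    ¬ Module.Free R (orth v) ∧
      ∀ S : Set (Fin m → R), Submodule.span R S = orth v → m ≤ S.ncard := by
  obtain ⟨w, hw⟩ := hnotroot
  -- the `p`-torsion of `R` is nontrivial
  have htor : 1 < Nat.card (nsmulAddMonoidHom (α := R) p).ker := by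
    rw [Finite.one_lt_card_iff_nontrivial]
    refine ⟨⟨(p : R) ^ (n - 1), ?_⟩, 0, ?_⟩
    · rw [AddMonoidHom.mem_ker]
      change p • (p : R) ^ (n - 1) = 0
      rw [nsmul_eq_mul, ← pow_succ', Nat.sub_add_cancel hn, hpn]
    · intro h
      exact hpn1 (congrArg Subtype.val h)
  -- all the `p`-torsion of `R^m` lies in `orth v`
  have hmem : ∀ x : Fin m → R, p • x = 0 → x ∈ orth v := by
    intro x hx
    change ∑ i, v i * x i = 0
    refine Finset.sum_eq_zero fun i _ => ?_
    have h := congrFun hx i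
    simp only [Pi.smul_apply, nsmul_eq_mul, Pi.zero_apply] at h
    rw [hw, Pi.smul_apply, smul_eq_mul, mul_right_comm, h, zero_mul]
  have hM : Nat.card (nsmulAddMonoidHom (α := R) p).ker ^ m
      ≤ Nat.card (nsmulAddMonoidHom (α := orth v) p).ker := by
    have h := aux_card_pi (R := R) (ι := Fin m) p
    rw [Fintype.card_fin] at h
    rw [← h]
    refine Nat.card_le_card_of_injective
      (fun x => ⟨⟨x.1, hmem x.1 x.2⟩, Subtype.ext x.2⟩) ?_
    intro x y hxy
    exact Subtype.ext (congrArg (fun z => z.1.1) hxy)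
  have key : ∀ (ι : Type) [Fintype ι] (f : (ι → R) →ₗ[R] orth v), Function.Surjective f →
      m ≤ Fintype.card ι := by
    intro ι _ f hf
    have h := aux_card_le p f.toAddMonoidHom hf
    rw [aux_card_pi] at h
    exact (Nat.pow_le_pow_iff_right htor).1 (hM.trans h)
  constructor
  · intro hfree
    let b := Module.Free.chooseBasis R (orth v)
    have hk := key _ b.equivFun.symm.toLinearMap b.equivFun.symm.surjective
    have hc : Nat.card (orth v)
        = Nat.card R ^ Fintype.card (Module.Free.ChooseBasisIndex R (orth v)) := by
      rw [Nat.card_congr b.equivFun.toEquiv, Nat.card_fun,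
        Nat.card_eq_fintype_card (α := Module.Free.ChooseBasisIndex R (orth v))]
    have hc2 : Nat.card (Fin m → R) ≤ Nat.card (orth v) := by
      rw [hc, Nat.card_fun, Nat.card_fin]
      exact Nat.pow_le_pow_right Nat.card_pos hk
    have hbij := (Nat.bijective_iff_injective_and_card (Subtype.val : orth v → (Fin m → R))).2
      ⟨Subtype.val_injective,
        le_antisymm (Nat.card_le_card_of_injective _ Subtype.val_injective) hc2⟩
    apply hv
    funext i
    obtain ⟨⟨x, hx⟩, hxi⟩ := hbij.2 (Pi.single i 1)
    subst hxi
    have hx' : ∑ j, v j * (Pi.single i 1 : Fin m → R) j = 0 := hx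
    simpa [Pi.single_apply] using hx'
  · intro S hS
    have : Fintype S := Fintype.ofFinite S
    rw [← Nat.card_coe_set_eq, Nat.card_eq_fintype_card]
    have hr : LinearMap.range (Fintype.linearCombination R (Subtype.val : S → (Fin m → R)))
        = orth v := by
      rw [Fintype.range_linearCombination, Subtype.range_coe, hS]
    refine key S ((Fintype.linearCombination R (Subtype.val : S → (Fin m → R))).codRestrict
      (orth v) fun c => hr ▸ LinearMap.mem_range_self _ c) ?_
    rintro ⟨x, hx⟩
    rw [← hr] at hx
    obtain ⟨c, hc⟩ := hx
    exact ⟨c, Subtype.ext hc⟩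
end

section
/- Let m, k ≥ 1 and let Λ = (α_1, …, α_k) be a family of vectors of R^m such that the map v ↦ c(v) is injective. For every nonzero v ∈ R^m, the codeword c(v) is a minimal codeword of the code C(Λ) if and only if M(v,Λ) = O(v). -/
theorem aux_decomp {R : Type} [CommRing R] [IsLocalRing R] (p n : ℕ)
    (hmax : IsLocalRing.maximalIdeal R = Ideal.span {(p : R)})
    (hpn : (p : R) ^ n = 0) (a : R) : ∃ r u, IsUnit u ∧ a = (p : R) ^ r * u := by
  have key : ∀ j : ℕ, (∃ r u, IsUnit u ∧ a = (p : R) ^ r * u) ∨ ∃ b, a = (p : R) ^ j * b := by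
    intro j
    induction j with
    | zero => exact Or.inr ⟨a, by simp⟩
    | succ j ih =>
      rcases ih with h | ⟨b, hb⟩
      · exact Or.inl h
      · by_cases hu : IsUnit b
        · exact Or.inl ⟨j, b, hu, hb⟩
        · have : b ∈ IsLocalRing.maximalIdeal R := (IsLocalRing.mem_maximalIdeal b).2 hu
          rw [hmax, Ideal.mem_span_singleton] at this
          obtain ⟨c, rfl⟩ := this
          exact Or.inr ⟨c, by rw [hb]; ring⟩
  rcases key n with h | ⟨b, hb⟩
  · exact h
  · exact ⟨n, 1, isUnit_one, by rw [hb, hpn]; ring⟩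

theorem aux_baer {R : Type} [CommRing R] [IsLocalRing R] (p n : ℕ)
    (hmax : IsLocalRing.maximalIdeal R = Ideal.span {(p : R)})
    (hn : 1 ≤ n) (hpn : (p : R) ^ n = 0) (hpn1 : (p : R) ^ (n - 1) ≠ 0) :
    Module.Baer R R := by
  classical
  intro I g
  have hex : ∃ r, (p : R) ^ r ∈ I := ⟨n, by rw [hpn]; exact I.zero_mem⟩
  obtain ⟨r, hr, hmin⟩ : ∃ r, (p : R) ^ r ∈ I ∧ ∀ s, (p : R) ^ s ∈ I → r ≤ s :=
    ⟨Nat.find hex, Nat.find_spec hex, fun s hs => Nat.find_min' hex hs⟩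
  have hrn : r ≤ n := hmin n (by rw [hpn]; exact I.zero_mem)
  have h0 : (p : R) ^ (n - r) * g ⟨_, hr⟩ = 0 := by
    rw [← smul_eq_mul, ← map_smul]
    have : (p : R) ^ (n - r) • (⟨(p : R) ^ r, hr⟩ : I) = 0 := by
      ext
      simp [← pow_add, Nat.sub_add_cancel hrn, hpn]
    rw [this, map_zero]
  obtain ⟨s, u, hu, hy⟩ := aux_decomp p n hmax hpn (g ⟨_, hr⟩)
  have hs : r ≤ s := by
    by_contra hlt
    apply hpn1
    rw [hy, ← mul_assoc, hu.mul_left_eq_zero, ← pow_add] at h0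
    exact pow_eq_zero_of_le (by omega) h0
  refine ⟨LinearMap.mulLeft R ((p : R) ^ (s - r) * u), ?_⟩
  intro x hx
  obtain ⟨t, w, hw, rfl⟩ := aux_decomp p n hmax hpn x
  have ht : r ≤ t := hmin t ((Ideal.mul_unit_mem_iff_mem I hw).1 hx)
  have e : (⟨(p : R) ^ t * w, hx⟩ : I) = ((p : R) ^ (t - r) * w) • ⟨(p : R) ^ r, hr⟩ := by
    ext
    obtain ⟨d, rfl⟩ := Nat.exists_eq_add_of_le ht
    simp only [Nat.add_sub_cancel_left, Submodule.coe_smul, smul_eq_mul]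
    ring
  rw [e, map_smul, hy]
  obtain ⟨d, rfl⟩ := Nat.exists_eq_add_of_le ht
  obtain ⟨d', rfl⟩ := Nat.exists_eq_add_of_le hs
  simp only [Nat.add_sub_cancel_left, LinearMap.mulLeft_apply, smul_eq_mul]
  ring

theorem aux_sep {R : Type} [CommRing R] [IsLocalRing R] (p n : ℕ)
    (hmax : IsLocalRing.maximalIdeal R = Ideal.span {(p : R)})
    (hn : 1 ≤ n) (hpn : (p : R) ^ n = 0) (hpn1 : (p : R) ^ (n - 1) ≠ 0)
    {V : Type} [AddCommGroup V] [Module R V] (N : Submodule R V) (x : V) (hx : x ∉ N) :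
    ∃ f : V →ₗ[R] R, (∀ y ∈ N, f y = 0) ∧ f x ≠ 0 := by
  have hinj : Module.Injective R R := (aux_baer p n hmax hn hpn hpn1).injective
  let T : R →ₗ[R] (V ⧸ N) := LinearMap.toSpanSingleton R _ (N.mkQ x)
  let S : R →ₗ[R] R := LinearMap.mulRight R ((p : R) ^ (n - 1))
  have hker : LinearMap.ker T ≤ LinearMap.ker S := by
    intro a ha
    have ha' : a • x ∈ N := by
      have : a • N.mkQ x = 0 := by simpa [T] using ha
      rw [← map_smul] at this
      exact (Submodule.Quotient.mk_eq_zero N).1 this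
    have hau : ¬ IsUnit a := by
      intro hu
      exact hx ((N.smul_mem_iff_of_isUnit hu).1 ha')
    have : a ∈ IsLocalRing.maximalIdeal R := (IsLocalRing.mem_maximalIdeal a).2 hau
    rw [hmax, Ideal.mem_span_singleton] at this
    obtain ⟨c, rfl⟩ := this
    have e : (p : R) * c * (p : R) ^ (n - 1) = (p : R) ^ (n - 1 + 1) * c := by ring
    rw [Nat.sub_add_cancel hn, hpn, zero_mul] at e
    simpa [S] using e
  obtain ⟨h, hh⟩ := hinj.out ((LinearMap.ker T).liftQ T le_rfl)
    (LinearMap.ker_eq_bot.1 (Submodule.ker_liftQ_eq_bot _ _ _ le_rfl))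
    ((LinearMap.ker T).liftQ S hker)
  refine ⟨h ∘ₗ N.mkQ, ?_, ?_⟩
  · intro y hy
    have : N.mkQ y = 0 := by simpa using hy
    simp only [LinearMap.comp_apply, this, map_zero]
  · have := hh ((LinearMap.ker T).mkQ 1)
    have e : h (N.mkQ x) = (p : R) ^ (n - 1) := by
      simp only [Submodule.mkQ_apply, Submodule.liftQ_apply] at this
      simpa [T, S] using this
    rw [LinearMap.comp_apply, e]
    exact hpn1

theorem aux_factor {R : Type} [CommRing R] (hb : Module.Baer R R) {V : Type} [AddCommGroup V]
    [Module R V] (f g : V →ₗ[R] R) (h : LinearMap.ker f ≤ LinearMap.ker g) :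
    ∃ a : R, ∀ x, g x = a * f x := by
  have hinj : Module.Injective R R := hb.injective
  obtain ⟨k, hk⟩ := hinj.out ((LinearMap.ker f).liftQ f le_rfl)
    (LinearMap.ker_eq_bot.1 (Submodule.ker_liftQ_eq_bot _ _ _ le_rfl))
    ((LinearMap.ker f).liftQ g h)
  refine ⟨k 1, fun x => ?_⟩
  have := hk ((LinearMap.ker f).mkQ x)
  have e : k (f x) = g x := by simpa using this
  rw [← e, mul_comm, ← smul_eq_mul, ← map_smul, smul_eq_mul, mul_one]

theorem stmt_2
    (R : Type) [CommRing R] [IsLocalRing R] [Fintype R]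
    (p n ℓ : ℕ) (hp : p.Prime) (hn : 1 ≤ n)
    (hmax : IsLocalRing.maximalIdeal R = Ideal.span {(p : R)})
    (hpn : (p : R) ^ n = 0) (hpn1 : (p : R) ^ (n - 1) ≠ 0)
    (hres : Nat.card (IsLocalRing.ResidueField R) = p ^ ℓ)
    (m k : ℕ) (hm : 1 ≤ m) (hk : 1 ≤ k) (Λ : Fin k → Fin m → R)
    (hinj : Function.Injective (evalMap Λ))
    (v : Fin m → R) (hv : v ≠ 0) :
    IsMinimalWord (code Λ) (evalMap Λ v) ↔ MvLam Λ v = orth v := by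
  classical
  have hb := aux_baer p n hmax hn hpn hpn1
  have hle : ∀ w, (∀ i, evalMap Λ w i ≠ 0 → evalMap Λ v i ≠ 0) ↔ MvLam Λ v ≤ orth w := by
    intro w
    unfold MvLam
    rw [Submodule.span_le]
    constructor
    · rintro h _ ⟨i, rfl, hi⟩
      by_contra hne
      exact h i hne hi
    · intro h i hne hi
      exact hne (h ⟨i, rfl, hi⟩)
  have hdot : ∀ f : (Fin m → R) →ₗ[R] R, ∃ w, ∀ x, f x = dot w x := by
    intro f
    refine ⟨fun i => f (Pi.single i 1), fun x => ?_⟩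
    rw [LinearMap.pi_apply_eq_sum_univ f x]
    refine Finset.sum_congr rfl fun i _ => ?_
    rw [smul_eq_mul, mul_comm]
    congr 2
    ext j
    simp [Pi.single_apply, eq_comm]
  constructor
  · rintro ⟨-, hmin⟩
    apply le_antisymm ((hle v).1 fun i h => h)
    intro x hx
    by_contra hxN
    obtain ⟨f, hf, hfx⟩ := aux_sep p n hmax hn hpn hpn1 _ x hxN
    obtain ⟨w, hw⟩ := hdot f
    obtain ⟨a, ha⟩ := hmin (evalMap Λ w) ⟨w, rfl⟩ ((hle w).2 fun y hy => by
      change dot w y = 0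
      rw [← hw, hf y hy])
    rw [← map_smul] at ha
    have hwa := hinj ha
    apply hfx
    have hx0 : dot v x = 0 := hx
    rw [hw, hwa]
    have : dot (a • v) x = a * dot v x := by simp [dot, Finset.mul_sum, mul_assoc]
    rw [this, hx0, mul_zero]
  · intro hM
    refine ⟨fun h => hv (hinj (by rw [h, map_zero])), ?_⟩
    rintro _ ⟨w, rfl⟩ hsupp
    have h := (hle w).1 hsupp
    rw [hM] at h
    obtain ⟨a, ha⟩ := aux_factor hb (dotLin v) (dotLin w) h
    refine ⟨a, ?_⟩
    ext i
    exact ha (Λ i)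
end

section
/- Let m ≥ 2 and let Λ = (α_1, …, α_k) be a family of vectors of R^m such that the map v ↦ c(v) is injective and the code C(Λ) is a minimal linear code of length k. Let Λ* be the subfamily of Λ consisting of those α_i with α_i ∉ pR^m (i.e., obtained from Λ by removing all vectors that are scalar multiples of zero divisors of R), and let C(Λ*) = {(v·α)_{α ∈ Λ*} : v ∈ R^m} be the corresponding linear code. Then C(Λ*) is a minimal linear code. -/
theorem dot_smul_left' {R : Type*} [CommRing R] {m : ℕ} (c : R) (v w : Fin m → R) :
    dot (c • v) w = c * dot v w := by
  simp [dot, Finset.mul_sum, mul_assoc]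

theorem dot_smul_right' {R : Type*} [CommRing R] {m : ℕ} (c : R) (v w : Fin m → R) :
    dot v (c • w) = c * dot v w := by
  simp [dot, Finset.mul_sum, mul_left_comm]

theorem dot_add_left' {R : Type*} [CommRing R] {m : ℕ} (v v' w : Fin m → R) :
    dot (v + v') w = dot v w + dot v' w := by
  simp [dot, add_mul, Finset.sum_add_distrib]

/-- Every element is a power of `p` times a unit. -/
theorem exists_pow_unit {R : Type*} [CommRing R] [IsLocalRing R] (p : R) (n : ℕ)
    (hmax : IsLocalRing.maximalIdeal R = Ideal.span {p}) (hpn : p ^ n = 0) (x : R) :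
    ∃ (r : ℕ) (u : R), IsUnit u ∧ x = p ^ r * u := by
  by_contra hcon
  have key : ∀ r : ℕ, p ^ r ∣ x := by
    intro r
    induction r with
    | zero => simp
    | succ r ih =>
      obtain ⟨y, hy⟩ := ih
      have hyu : ¬ IsUnit y := fun h => hcon ⟨r, y, h, hy⟩
      have : y ∈ Ideal.span {p} := by
        rw [← hmax]; exact (IsLocalRing.mem_maximalIdeal y).2 hyu
      obtain ⟨z, hz⟩ := Ideal.mem_span_singleton.1 this
      exact ⟨z, by rw [hy, hz]; ring⟩
  have h0 := key n
  rw [hpn, zero_dvd_iff] at h0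
  exact hcon ⟨n, 1, isUnit_one, by simp [h0, hpn]⟩

theorem dvd_total' {R : Type*} [CommRing R] [IsLocalRing R] (p : R) (n : ℕ)
    (hmax : IsLocalRing.maximalIdeal R = Ideal.span {p}) (hpn : p ^ n = 0) (x y : R) :
    x ∣ y ∨ y ∣ x := by
  obtain ⟨r, u, hu, rfl⟩ := exists_pow_unit p n hmax hpn x
  obtain ⟨s, t, ht, rfl⟩ := exists_pow_unit p n hmax hpn y
  rcases le_total r s with h | h
  · left; rw [hu.mul_right_dvd]; exact (pow_dvd_pow p h).mul_right t
  · right; rw [ht.mul_right_dvd]; exact (pow_dvd_pow p h).mul_right u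

theorem stmt_5
    (R : Type) [CommRing R] [IsLocalRing R] [Fintype R]
    (p n ℓ : ℕ) (hp : p.Prime) (hn : 1 ≤ n)
    (hmax : IsLocalRing.maximalIdeal R = Ideal.span {(p : R)})
    (hpn : (p : R) ^ n = 0) (hpn1 : (p : R) ^ (n - 1) ≠ 0)
    (hres : Nat.card (IsLocalRing.ResidueField R) = p ^ ℓ)
    (m k : ℕ) (hm : 2 ≤ m) (hk : 1 ≤ k) (Λ : Fin k → Fin m → R)
    (hinj : Function.Injective (evalMap Λ))
    (hmin : IsMinimalCode (code Λ))
    (S : Set (Fin k)) (hS : S = {i | ¬ ∃ w : Fin m → R, Λ i = (p : R) • w}) :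
    IsMinimalCode (code (fun i : S => Λ i)) := by
  set P : R := (p : R) with hP
  -- minimality of `C(Λ)` transported to vectors
  have M : ∀ v w : Fin m → R, v ≠ 0 →
      (∀ i, dot v (Λ i) = 0 → dot w (Λ i) = 0) → ∃ a : R, w = a • v := by
    intro v w hv h
    have hne : evalMap Λ v ≠ 0 := fun h0 => hv (hinj (by rw [h0, map_zero]))
    obtain ⟨a, ha⟩ := (hmin _ ⟨v, rfl⟩ hne).2 _ ⟨w, rfl⟩ (fun i hi h0 => hi (h i h0))
    exact ⟨a, hinj (by rw [ha, map_smul])⟩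
  have hnS : ∀ i, i ∉ S → ∃ β : Fin m → R, Λ i = P • β := by
    intro i hi
    by_contra hc
    exact hi (by rw [hS]; exact hc)
  have nonunit : ∀ x : R, ¬ IsUnit x → P ∣ x := by
    intro x hx
    rw [← Ideal.mem_span_singleton, ← hmax]
    exact (IsLocalRing.mem_maximalIdeal x).2 hx
  have hPn : P * P ^ (n - 1) = 0 := by
    rw [← pow_succ', Nat.sub_add_cancel hn, hpn]
  -- the exceptional case
  have X : ∀ w : Fin m → R, P • w ≠ 0 →
      (∀ i ∈ S, P * dot w (Λ i) = 0 → dot w (Λ i) = 0) → False := by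
    intro w hw h
    have Y : ∀ y : Fin m → R, P • y = 0 → ∃ b : R, y = b • w := by
      intro y hy
      have hPu : P • (w + y) = P • w := by rw [smul_add, hy, add_zero]
      have hu : w + y ≠ 0 := fun h0 => hw (by rw [← hPu, h0, smul_zero])
      obtain ⟨a, ha⟩ := M (w + y) w hu (by
        intro i hi
        by_cases hiS : i ∈ S
        · apply h i hiS
          rw [← dot_smul_left', ← hPu, dot_smul_left', hi, mul_zero]
        · obtain ⟨β, hβ⟩ := hnS i hiS
          rw [hβ, dot_smul_right', ← dot_smul_left'] at hi ⊢
          rw [← hPu, hi])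
      have hau : IsUnit a := by
        by_contra hna
        have h1 : IsUnit (1 - a) := by
          rcases IsLocalRing.isUnit_or_isUnit_one_sub_self a with h | h
          · exact absurd h hna
          · exact h
        have h2 : (1 - a) • (P • w) = 0 := by
          rw [sub_smul, one_smul, ← hPu, smul_comm a P, ← ha, hPu, sub_self]
        exact hw ((h1.smul_eq_zero).1 h2)
      obtain ⟨a', ha'⟩ := hau.exists_left_inv
      refine ⟨a' - 1, ?_⟩
      have h3 : a' • w = w + y := by
        conv_lhs => rw [ha]
        rw [smul_smul, ha', one_smul]
      rw [sub_smul, one_smul, h3, add_sub_cancel_left]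
    let e0 : Fin m := ⟨0, by omega⟩
    let e1 : Fin m := ⟨1, by omega⟩
    have h01 : e0 ≠ e1 := by simp [e0, e1]
    have hs : ∀ e : Fin m, P • (Pi.single e (P ^ (n - 1)) : Fin m → R) = 0 := by
      intro e
      rw [← Pi.single_smul, smul_eq_mul, hPn, Pi.single_zero]
    obtain ⟨b, hb⟩ := Y _ (hs e0)
    obtain ⟨c, hc⟩ := Y _ (hs e1)
    have hb0 := congrFun hb e0
    have hb1 := congrFun hb e1
    have hc0 := congrFun hc e0
    have hc1 := congrFun hc e1
    rw [Pi.single_eq_same, Pi.smul_apply, smul_eq_mul] at hb0 hc1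
    rw [Pi.single_eq_of_ne h01.symm, Pi.smul_apply, smul_eq_mul] at hb1
    rw [Pi.single_eq_of_ne h01, Pi.smul_apply, smul_eq_mul] at hc0
    rcases dvd_total' P n hmax hpn b c with ⟨d, hd⟩ | ⟨d, hd⟩
    · apply hpn1
      rw [hc1, hd, mul_right_comm, ← hb1, zero_mul]
    · apply hpn1
      rw [hb0, hd, mul_right_comm, ← hc0, zero_mul]
  -- main induction
  have main : ∀ t : ℕ, ∀ v w : Fin m → R, v ≠ 0 → P ^ t • w = 0 →
      (∀ i ∈ S, dot v (Λ i) = 0 → dot w (Λ i) = 0) → ∃ a : R, w = a • v := by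
    intro t
    induction t with
    | zero =>
      intro v w _ hw _
      exact ⟨0, by simpa using hw⟩
    | succ t ih =>
      intro v w hv hw h
      obtain ⟨a, ha⟩ := ih v (P • w) hv (by rw [smul_smul, ← pow_succ, hw])
        (fun i hi h0 => by rw [dot_smul_left', h i hi h0, mul_zero])
      by_cases hau : IsUnit a
      · exfalso
        refine X w (fun h0 => hv ?_) ?_
        · rw [h0] at ha
          exact (hau.smul_eq_zero).1 ha.symm
        · intro i hi h0
          apply h i hi
          rw [← dot_smul_left', ha, dot_smul_left'] at h0
          exact (hau.mul_right_eq_zero).1 h0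
      · obtain ⟨b, rfl⟩ := nonunit a hau
        apply M v w hv
        intro i h0
        by_cases hiS : i ∈ S
        · exact h i hiS h0
        · obtain ⟨β, hβ⟩ := hnS i hiS
          rw [hβ, dot_smul_right'] at h0 ⊢
          rw [← dot_smul_left', ha, dot_smul_left', mul_right_comm, h0, zero_mul]
  rintro _ ⟨v, rfl⟩ hne
  refine ⟨hne, ?_⟩
  rintro _ ⟨w, rfl⟩ h
  have hv : v ≠ 0 := by
    rintro rfl
    exact hne (map_zero _)
  obtain ⟨a, ha⟩ := main n v w hv (by rw [hpn, zero_smul]) (by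
    intro i hi h0
    by_contra hw
    exact h ⟨i, hi⟩ hw h0)
  exact ⟨a, by rw [ha, map_smul]⟩
end

section
/- Let m ≥ 2 and let Λ = (α_1, …, α_k) be a family of nonzero vectors of R^m such that the map v ↦ c(v) is injective, and suppose that C(Λ) is a minimal linear code of length k. Then: (i) if m ≥ 3, then k > (m−1)·q^n + q^(n−m) as real numbers (where q^(n−m) means q^n / q^m); (ii) if m = 2 and n ≥ 3, then k > q^n + q^(n−2) + 1; (iii) if m = 2 and n = 2, then k ≥ q^2 + 2; (iv) if m = 2 and n = 1, then k ≥ q + 1. -/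
section helpers

open IsLocalRing

lemma card_ker_aux {R M : Type} [CommRing R] [AddCommGroup M] [Module R M] [Finite M] {m : ℕ}
    (α : Fin m → R) (j : Fin m) (hj : IsUnit (α j)) :
    Nat.card {v : Fin m → M // ∑ i, α i • v i = 0} * Nat.card M = Nat.card M ^ m := by
  classical
  let f : (Fin m → M) →ₗ[R] M := ∑ i, α i • LinearMap.proj i
  have hf : ∀ v, f v = ∑ i, α i • v i := by
    intro v; simp [f, LinearMap.sum_apply]
  have hsurj : Function.Surjective f := by
    intro y
    obtain ⟨u, hu⟩ := hj
    refine ⟨Pi.single j ((u⁻¹ : Rˣ).1 • y), ?_⟩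
    rw [hf, Finset.sum_eq_single j]
    · rw [Pi.single_eq_same, ← hu, smul_smul]; simp
    · intro b _ hb; rw [Pi.single_eq_of_ne hb]; simp
    · simp
  have h := Submodule.card_eq_card_quotient_mul_card (LinearMap.ker f)
  rw [Nat.card_congr (f.quotKerEquivOfSurjective hsurj).toEquiv, Nat.card_fun, Nat.card_fin] at h
  rw [h]
  congr 1
  apply Nat.card_congr
  exact Equiv.subtypeEquivRight (fun v => by rw [LinearMap.mem_ker, hf])

lemma card_max {R : Type} [CommRing R] [IsLocalRing R] [Fintype R] :
    Nat.card R = Nat.card (ResidueField R) * Nat.card (maximalIdeal R) := by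
  have h := Submodule.card_eq_card_quotient_mul_card (maximalIdeal R)
  rw [h, mul_comm]; rfl

lemma not_mem_span_unit {R : Type} [CommRing R] [IsLocalRing R] {x : R} (r : R)
    (hx : x ≠ 0) (h : x * r = 0) : r ∈ maximalIdeal R := by
  rw [mem_maximalIdeal, mem_nonunits_iff]
  intro hu
  exact hx ((IsUnit.mul_left_eq_zero hu).1 h)

lemma card_step {R : Type} [CommRing R] [IsLocalRing R] [Fintype R] (p : R)
    (hmax : maximalIdeal R = Ideal.span {p}) (i : ℕ) (hi : p ^ i ≠ 0) :
    Nat.card (Ideal.span {p ^ i}) =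
      Nat.card (ResidueField R) * Nat.card (Ideal.span {p ^ (i+1)}) := by
  let g : R →ₗ[R] R := LinearMap.mulLeft R (p ^ i)
  let g' : maximalIdeal R →ₗ[R] R := g.comp (maximalIdeal R).subtype
  have h1 := Submodule.card_eq_card_quotient_mul_card (LinearMap.ker g)
  have h2 := Submodule.card_eq_card_quotient_mul_card (LinearMap.ker g')
  rw [Nat.card_congr g.quotKerEquivRange.toEquiv] at h1
  rw [Nat.card_congr g'.quotKerEquivRange.toEquiv] at h2
  have r1 : LinearMap.range g = Ideal.span {p ^ i} := by
    ext x
    simp only [LinearMap.mem_range, g, LinearMap.mulLeft_apply, Ideal.mem_span_singleton', mul_comm]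
  have r2 : LinearMap.range g' = Ideal.span {p ^ (i+1)} := by
    ext x
    simp only [LinearMap.mem_range, g', g, LinearMap.comp_apply, Submodule.subtype_apply,
      LinearMap.mulLeft_apply, Ideal.mem_span_singleton']
    constructor
    · rintro ⟨⟨y, hy⟩, rfl⟩
      rw [hmax, Ideal.mem_span_singleton'] at hy
      obtain ⟨a, rfl⟩ := hy
      exact ⟨a, by simp only []; ring⟩
    · rintro ⟨a, rfl⟩
      refine ⟨⟨a * p, ?_⟩, by simp only []; ring⟩
      rw [hmax, Ideal.mem_span_singleton']; exact ⟨a, rfl⟩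
  have k12 : Nat.card (LinearMap.ker g') = Nat.card (LinearMap.ker g) := by
    refine Nat.card_congr
      { toFun := fun x => ⟨x.1.1, x.2⟩
        invFun := fun x => ⟨⟨x.1, not_mem_span_unit x.1 hi x.2⟩, x.2⟩
        left_inv := fun x => rfl
        right_inv := fun x => rfl }
  rw [r1] at h1
  rw [r2, k12] at h2
  have h3 := card_max (R := R)
  rw [h1, h2] at h3
  have hpos : 0 < Nat.card (LinearMap.ker g) := Nat.card_pos
  apply Nat.eq_of_mul_eq_mul_right hpos
  rw [mul_assoc]; linarith

lemma card_pow {R : Type} [CommRing R] [IsLocalRing R] [Fintype R] (p : R) (n : ℕ)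
    (hmax : maximalIdeal R = Ideal.span {p}) (hpn : p ^ n = 0) (hpn1 : p ^ (n - 1) ≠ 0) :
    Nat.card R = Nat.card (ResidueField R) ^ n := by
  have key : ∀ d, d ≤ n → Nat.card (Ideal.span {p ^ (n - d)}) = Nat.card (ResidueField R) ^ d := by
    intro d
    induction d with
    | zero => intro _; simp [hpn]
    | succ d ih =>
      intro hd
      rw [card_step p hmax (n - (d+1)), show n - (d+1) + 1 = n - d by omega, ih (by omega)]
      · ring
      · intro h0
        apply hpn1
        rw [show n - 1 = (n - (d+1)) + d by omega, pow_add, h0, zero_mul]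
  have := key n le_rfl
  rw [← this]
  simp only [Nat.sub_self, pow_zero, Ideal.span_singleton_one]
  exact (Nat.card_congr (Submodule.topEquiv (R := R) (M := R)).toEquiv).symm

open Classical in
/-- At least `m-1` unimodular members of `Λ` are orthogonal to a unimodular `v`. -/
lemma many_orth {R : Type} [CommRing R] [IsLocalRing R] [Fintype R] (p : R) (n : ℕ) (hn : 1 ≤ n)
    (hmax : maximalIdeal R = Ideal.span {p}) (hpn : p ^ n = 0) (hpn1 : p ^ (n - 1) ≠ 0)
    {m k : ℕ} (Λ : Fin k → Fin m → R)
    (hinj : Function.Injective (evalMap Λ)) (hmin : IsMinimalCode (code Λ))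
    (v : Fin m → R) (hv : ∃ j, IsUnit (v j)) :
    m - 1 ≤ (Finset.univ.filter
      (fun i => (∃ j, IsUnit (Λ i j)) ∧ dot v (Λ i) = 0)).card := by
  set S := Finset.univ.filter (fun i => (∃ j, IsUnit (Λ i j)) ∧ dot v (Λ i) = 0) with hS
  by_contra hlt
  push Not at hlt
  obtain ⟨j, hj⟩ := hv
  let F := ResidueField R
  let T : (Fin m → F) →ₗ[F] (S → F) :=
    LinearMap.pi (fun s => ∑ i, (residue R (Λ s.1 i)) • LinearMap.proj i)
  have hT : ∀ w s, T w s = ∑ i, residue R (Λ s.1 i) * w i := by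
    intro w s; simp [T, LinearMap.sum_apply]
  have hrank := LinearMap.finrank_range_add_finrank_ker T
  have hr : Module.finrank F (LinearMap.range T) ≤ S.card := by
    have := Submodule.finrank_le (LinearMap.range T)
    simpa using this
  simp only [Module.finrank_fin_fun] at hrank
  have hker : 2 ≤ Module.finrank F (LinearMap.ker T) := by omega
  let vb : Fin m → F := fun i => residue R (v i)
  have hnle : ¬ LinearMap.ker T ≤ Submodule.span F {vb} := by
    intro hle
    have h1 := Submodule.finrank_mono hle
    have h2 := finrank_span_le_card (R := F) ({vb} : Set (Fin m → F))
    simp at h2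
    omega
  obtain ⟨wb, hwb, hwn⟩ := SetLike.not_le_iff_exists.1 hnle
  choose w hw using fun i => residue_surjective (R := R) (wb i)
  have hkill : ∀ r : R, r ∈ maximalIdeal R → p ^ (n-1) * r = 0 := by
    intro r hr
    rw [hmax, Ideal.mem_span_singleton'] at hr
    obtain ⟨a, rfl⟩ := hr
    have : p ^ (n-1) * (a * p) = a * p ^ ((n-1)+1) := by ring
    rw [this, show n - 1 + 1 = n by omega, hpn, mul_zero]
  have hv0 : v ≠ 0 := by
    intro h; rw [h] at hj; simp at hj
  have hc0 : evalMap Λ v ≠ 0 := by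
    intro h; exact hv0 (hinj (by rw [h, map_zero]))
  obtain ⟨_, hm⟩ := hmin (evalMap Λ v) ⟨v, rfl⟩ hc0
  obtain ⟨a, ha⟩ := hm (evalMap Λ (p ^ (n-1) • w)) ⟨_, rfl⟩ (by
    intro i hne h0
    apply hne
    change dot v (Λ i) = 0 at h0
    have e : evalMap Λ (p ^ (n-1) • w) i = p ^ (n-1) * dot w (Λ i) := by
      rw [map_smul]; rfl
    rw [e]
    apply hkill
    by_cases hu : ∃ j, IsUnit (Λ i j)
    · have hiS : i ∈ S := by simp [hS, hu, h0]
      rw [LinearMap.mem_ker] at hwb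
      have := congrFun hwb ⟨i, hiS⟩
      rw [hT] at this
      rw [← residue_eq_zero_iff]
      simp only [dot, map_sum, map_mul, hw]
      simpa [mul_comm] using this
    · push Not at hu
      refine Ideal.sum_mem _ (fun t _ => Ideal.mul_mem_left _ _ ?_)
      exact (mem_maximalIdeal _).2 (hu t))
  rw [← map_smul] at ha
  have hE := hinj ha
  obtain ⟨u, hu⟩ := hj
  have hja := congrFun hE j
  simp only [Pi.smul_apply, smul_eq_mul, ← hu] at hja
  have ha' : a = p ^ (n-1) * (w j * (u⁻¹ : Rˣ).1) := by
    rw [← mul_assoc, hja, mul_assoc, Units.mul_inv, mul_one]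
  apply hwn
  rw [Submodule.mem_span_singleton]
  refine ⟨residue R (w j * (u⁻¹ : Rˣ).1), ?_⟩
  funext i
  have hi := congrFun hE i
  simp only [Pi.smul_apply, smul_eq_mul] at hi
  have := not_mem_span_unit (w i - (w j * (u⁻¹ : Rˣ).1) * v i) hpn1 (by
    rw [mul_sub, hi, ha']; ring)
  rw [← residue_eq_zero_iff, map_sub, map_mul, hw, sub_eq_zero] at this
  exact this.symm

open Classical in
lemma double_count {R : Type} [CommRing R] [IsLocalRing R] [Fintype R] (p : R) (n : ℕ)
    (hn : 1 ≤ n)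
    (hmax : maximalIdeal R = Ideal.span {p}) (hpn : p ^ n = 0) (hpn1 : p ^ (n - 1) ≠ 0)
    {m k : ℕ} (hm : 2 ≤ m) (Λ : Fin k → Fin m → R)
    (hinj : Function.Injective (evalMap Λ)) (hmin : IsMinimalCode (code Λ)) (q : ℕ)
    (hres : Nat.card (ResidueField R) = q) :
    ((m : ℝ) - 1) * q ^ (n-1) * (q ^ m - 1) ≤ k * (q ^ (m-1) - 1) := by
  have hR : Nat.card R = q ^ n := by rw [card_pow p n hmax hpn hpn1, hres]
  haveI : Finite (IsLocalRing.ResidueField R) :=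
    Finite.of_surjective _ (IsLocalRing.residue_surjective (R := R))
  have hqpos : 0 < q := by rw [← hres]; exact Nat.card_pos
  have hP : Nat.card (maximalIdeal R) = q ^ (n-1) := by
    have := card_max (R := R)
    rw [hR, hres] at this
    apply Nat.eq_of_mul_eq_mul_left hqpos
    rw [← this, ← pow_succ', show n - 1 + 1 = n by omega]
  set N := q ^ (n-1) with hN
  have hNpos : 0 < N := by positivity
  have hR' : Nat.card R = q * N := by rw [hR, hN, ← pow_succ', show n - 1 + 1 = n by omega]
  -- unimodular vectors
  set U : Finset (Fin m → R) := Finset.univ.filter (fun v => ∃ j, IsUnit (v j)) with hU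
  have cP : ∀ Q : (Fin m → R) → Prop,
      (Finset.univ.filter (fun v => ¬ (∃ j, IsUnit (v j)) ∧ Q v)).card
        = Nat.card {v : Fin m → maximalIdeal R // Q (fun i => (v i : R))} := by
    intro Q
    rw [← Fintype.card_subtype, ← Nat.card_eq_fintype_card]
    exact Nat.card_congr
      { toFun := fun v => ⟨fun i => ⟨v.1 i, (mem_maximalIdeal _).2
          (fun h => v.2.1 ⟨i, h⟩)⟩, v.2.2⟩
        invFun := fun v => ⟨fun i => v.1 i,
          fun ⟨i, h⟩ => (mem_maximalIdeal _).1 (v.1 i).2 h, v.2⟩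
        left_inv := fun v => rfl
        right_inv := fun v => rfl }
  have cU : U.card + N ^ m = (q * N) ^ m := by
    have h := cP (fun _ => True)
    simp only [and_true] at h
    have h2 := Finset.card_filter_add_card_filter_not (s := (Finset.univ : Finset (Fin m → R)))
      (fun v => ∃ j, IsUnit (v j))
    rw [h, Nat.card_congr (Equiv.subtypeUnivEquiv (fun _ => trivial)), Nat.card_fun,
      Nat.card_fin, hP, Finset.card_univ, ← Nat.card_eq_fintype_card, Nat.card_fun,
      Nat.card_fin, hR'] at h2
    exact h2
  have cA : ∀ α : Fin m → R, (∃ j, IsUnit (α j)) →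
      (U.filter (fun v => dot v α = 0)).card + N ^ (m-1) = (q * N) ^ (m-1) := by
    rintro α ⟨j, hj⟩
    have h := cP (fun v => dot v α = 0)
    have k1 := card_ker_aux (M := R) α j hj
    have k2 := card_ker_aux (M := maximalIdeal R) α j hj
    have e2 : Nat.card {v : Fin m → maximalIdeal R // dot (fun i => (v i : R)) α = 0}
        = Nat.card {v : Fin m → maximalIdeal R // ∑ i, α i • v i = 0} := by
      refine Nat.card_congr (Equiv.subtypeEquivRight (fun v => ?_))
      rw [← Subtype.coe_inj]
      simp [dot, mul_comm]
    have e1 : (Finset.univ.filter (fun v : Fin m → R => dot v α = 0)).card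
        = Nat.card {v : Fin m → R // ∑ i, α i • v i = 0} := by
      rw [← Fintype.card_subtype, ← Nat.card_eq_fintype_card]
      refine Nat.card_congr (Equiv.subtypeEquivRight (fun v => ?_))
      simp [dot, mul_comm]
    have hsplit := Finset.card_filter_add_card_filter_not
      (s := Finset.univ.filter (fun v : Fin m → R => dot v α = 0)) (fun v => ∃ j, IsUnit (v j))
    rw [Finset.filter_filter, Finset.filter_filter] at hsplit
    simp only [and_comm (a := dot _ α = 0)] at hsplit
    rw [h, e1, e2] at hsplit
    rw [hU, Finset.filter_filter]
    have hm1 : m = (m - 1) + 1 := by omega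
    have k1' : Nat.card {v : Fin m → R // ∑ i, α i • v i = 0} = (q * N) ^ (m-1) := by
      rw [hR'] at k1
      apply Nat.eq_of_mul_eq_mul_right (Nat.mul_pos hqpos hNpos)
      rw [k1, ← pow_succ, ← hm1]
    have k2' : Nat.card {v : Fin m → maximalIdeal R // ∑ i, α i • v i = 0} = N ^ (m-1) := by
      rw [hP] at k2
      apply Nat.eq_of_mul_eq_mul_right hNpos
      rw [k2, ← pow_succ, ← hm1]
    rw [k1', k2'] at hsplit
    exact hsplit
  have hdc : U.card * (m - 1) ≤ k * ((q * N) ^ (m-1) - N ^ (m-1)) := by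
    calc U.card * (m - 1) = ∑ v ∈ U, (m - 1) := by simp
      _ ≤ ∑ v ∈ U, (Finset.univ.filter
            (fun i => (∃ j, IsUnit (Λ i j)) ∧ dot v (Λ i) = 0)).card := by
          refine Finset.sum_le_sum (fun v hv => ?_)
          exact many_orth p n hn hmax hpn hpn1 Λ hinj hmin v (by simpa [hU] using hv)
      _ = ∑ i : Fin k, (U.filter (fun v => (∃ j, IsUnit (Λ i j)) ∧ dot v (Λ i) = 0)).card :=
          Finset.sum_card_bipartiteAbove_eq_sum_card_bipartiteBelow
            (fun v i => (∃ j, IsUnit (Λ i j)) ∧ dot v (Λ i) = 0)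
      _ ≤ ∑ i : Fin k, ((q * N) ^ (m-1) - N ^ (m-1)) := by
          refine Finset.sum_le_sum (fun i _ => ?_)
          by_cases hu : ∃ j, IsUnit (Λ i j)
          · have := cA (Λ i) hu
            simp only [hu, true_and]
            omega
          · simp [hu]
      _ = _ := by simp
  have hle : N ^ (m-1) ≤ (q * N) ^ (m-1) :=
    Nat.pow_le_pow_left (Nat.le_mul_of_pos_left _ hqpos) _
  have hdc' : (U.card : ℝ) * ((m : ℝ) - 1) ≤ k * ((q * N) ^ (m-1) - N ^ (m-1)) := by
    have : ((U.card * (m - 1) : ℕ) : ℝ) ≤ ((k * ((q * N) ^ (m-1) - N ^ (m-1)) : ℕ) : ℝ) := by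
      exact_mod_cast hdc
    rw [Nat.cast_mul, Nat.cast_mul, Nat.cast_sub (by omega), Nat.cast_sub hle] at this
    push_cast at this
    exact this
  have cU' : (U.card : ℝ) = (q * N) ^ m - N ^ m := by
    rw [eq_sub_iff_add_eq]; exact_mod_cast cU
  rw [cU'] at hdc'
  have hNr : (0 : ℝ) < (N : ℝ) ^ (m-1) := by positivity
  have hNm : (N : ℝ) ^ m = N ^ (m-1) * N := by
    rw [← pow_succ, show m - 1 + 1 = m by omega]
  rw [mul_pow, mul_pow, hNm] at hdc'
  have hNc : (N : ℝ) = (q : ℝ) ^ (n-1) := by rw [hN]; push_cast; rfl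
  rw [← hNc]
  refine le_of_mul_le_mul_left ?_ hNr
  linarith

end helpers

theorem stmt_6
    (R : Type) [CommRing R] [IsLocalRing R] [Fintype R]
    (p n ℓ : ℕ) (hp : p.Prime) (hn : 1 ≤ n)
    (hmax : IsLocalRing.maximalIdeal R = Ideal.span {(p : R)})
    (hpn : (p : R) ^ n = 0) (hpn1 : (p : R) ^ (n - 1) ≠ 0)
    (q : ℕ) (hq : q = p ^ ℓ) (hres : Nat.card (IsLocalRing.ResidueField R) = q)
    (m k : ℕ) (hm : 2 ≤ m) (hk : 1 ≤ k) (Λ : Fin k → Fin m → R)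
    (hΛ : ∀ i, Λ i ≠ 0)
    (hinj : Function.Injective (evalMap Λ))
    (hmin : IsMinimalCode (code Λ)) :
    (3 ≤ m → ((m : ℝ) - 1) * (q : ℝ) ^ n + (q : ℝ) ^ n / (q : ℝ) ^ m < (k : ℝ)) ∧
    (m = 2 → 3 ≤ n → q ^ n + q ^ (n - 2) + 1 < k) ∧
    (m = 2 → n = 2 → q ^ 2 + 2 ≤ k) ∧
    (m = 2 → n = 1 → q + 1 ≤ k) := by
  have hmain := double_count (p : R) n hn hmax hpn hpn1 hm Λ hinj hmin q hres
  haveI : Finite (IsLocalRing.ResidueField R) :=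
    Finite.of_surjective _ (IsLocalRing.residue_surjective (R := R))
  have hq2 : 2 ≤ q := by
    rw [← hres]
    have := Finite.one_lt_card (α := IsLocalRing.ResidueField R)
    omega
  have hq2r : (2 : ℝ) ≤ q := by exact_mod_cast hq2
  have hqn : (q : ℝ) ^ n = q ^ (n-1) * q := by
    rw [← pow_succ, show n - 1 + 1 = n by omega]
  have hNpos : (0 : ℝ) < (q : ℝ) ^ (n-1) := by positivity
  have h2 : m = 2 → q ^ (n-1) * (q + 1) ≤ k := by
    rintro rfl
    have : (q : ℝ) ^ (n-1) * (q + 1) ≤ k := by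
      refine le_of_mul_le_mul_right ?_ (show (0 : ℝ) < (q : ℝ) - 1 by linarith)
      norm_num at hmain
      linarith
    exact_mod_cast this
  refine ⟨?_, ?_, ?_, ?_⟩
  · intro hm3
    have hqm : (q : ℝ) ^ m = q ^ (m-1) * q := by
      rw [← pow_succ, show m - 1 + 1 = m by omega]
    have hm3r : (3 : ℝ) ≤ m := by exact_mod_cast hm3
    have hMq : (q : ℝ) ≤ (q : ℝ) ^ (m-1) := le_self_pow₀ (by linarith) (by omega)
    rw [hqm] at hmain
    rw [hqm, hqn]
    generalize (q : ℝ) ^ (n-1) = N at *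
    generalize (q : ℝ) ^ (m-1) = M at *
    have hM1 : 0 < M - 1 := by linarith
    have hM0 : 0 < M := by linarith
    refine lt_of_mul_lt_mul_right (lt_of_lt_of_le ?_ hmain) hM1.le
    have hq0 : (0 : ℝ) < q := by linarith
    have e : N * q / (M * q) = N / M := by field_simp
    rw [e]
    have h1 : N / M * (M - 1) < N := by
      rw [div_mul_eq_mul_div, div_lt_iff₀ hM0]; nlinarith
    have h3 : N ≤ ((m : ℝ) - 1) * N * (q - 1) := by
      have : 1 ≤ ((m : ℝ) - 1) * (q - 1) := by nlinarith
      nlinarith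
    nlinarith
  · intro hm2 hn3
    have h := h2 hm2
    obtain ⟨t, rfl⟩ : ∃ t, n = t + 3 := ⟨n - 3, by omega⟩
    have e1 : q ^ (t + 3 - 1) = q ^ t * q ^ 2 := by rw [← pow_add]; rfl
    have e2 : q ^ (t + 3 - 2) = q ^ t * q := by rw [← pow_succ]; rfl
    rw [e1] at h
    rw [e2, pow_add]
    have ht : 1 ≤ q ^ t := Nat.one_le_pow _ _ (by omega)
    generalize q ^ t = T at *
    have : T * q + 1 < T * q ^ 2 := by
      have h5 : 2 ≤ T * q := by nlinarith
      nlinarith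
    nlinarith
  · intro hm2 hn2
    have h := h2 hm2
    subst hn2
    norm_num at h
    nlinarith
  · intro hm2 hn1
    have h := h2 hm2
    subst hn1
    simpa using h
end

section
/- Let m ≥ 1, let f : R^m → R be a function, and assume that the map (a,v) ↦ c(a,v) defining C_f is injective. Let v ∈ R^m be a nonzero root word. Then the codeword c(0, v) is a minimal codeword of C_f if and only if there exist nonzero vectors β_1, …, β_m ∈ O(v) = {x ∈ R^m : v·x = 0} such that the vectors α_{β_1} = (f(β_1), β_1), …, α_{β_m} = (f(β_m), β_m) are R-linearly independent in R^(m+1). -/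
open IsLocalRing in
theorem aux_res_dvd {R : Type*} [CommRing R] [IsLocalRing R] {q : R}
    (hmax : maximalIdeal R = Ideal.span {q}) (x : R) : residue R x = 0 ↔ q ∣ x := by
  rw [residue_eq_zero_iff, hmax, Ideal.mem_span_singleton]

open IsLocalRing in
theorem aux_tors {R : Type*} [CommRing R] [IsLocalRing R] {q : R} {n : ℕ}
    (hq1 : q ^ (n - 1) ≠ 0) {j : ℕ} (hj : j < n) {y : R} (hy : q ^ j * y = 0) :
    residue R y = 0 := by
  by_contra h
  have hu := (residue_ne_zero_iff_isUnit y).1 h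
  have h0 : q ^ j = 0 := (hu.mul_left_eq_zero).1 hy
  exact hq1 (pow_eq_zero_of_le (by omega) h0)

open IsLocalRing in
theorem aux_ann {R : Type*} [CommRing R] [IsLocalRing R] {q : R} {n : ℕ}
    (hmax : maximalIdeal R = Ideal.span {q})
    (hq1 : q ^ (n - 1) ≠ 0) {a : R} (ha : q * a = 0) : ∀ j, j < n → q ^ j ∣ a := by
  intro j
  induction j with
  | zero => intro _; simp
  | succ j ih =>
    intro hj
    obtain ⟨b, rfl⟩ := ih (by omega)
    have : q ^ (j + 1) * b = 0 := by rw [← ha]; ring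
    obtain ⟨c, rfl⟩ := (aux_res_dvd hmax b).1 (aux_tors hq1 hj this)
    exact ⟨c, by ring⟩

open IsLocalRing in
theorem aux_li_iff {R : Type*} [CommRing R] [IsLocalRing R] {q : R} {n : ℕ} (hn : 1 ≤ n)
    (hmax : maximalIdeal R = Ideal.span {q}) (hq : q ^ n = 0)
    (hq1 : q ^ (n - 1) ≠ 0) {ι κ : Type*} [Fintype ι] (g : ι → κ → R) :
    LinearIndependent R g ↔
      LinearIndependent (ResidueField R) (fun i k => residue R (g i k)) := by
  rw [Fintype.linearIndependent_iff, Fintype.linearIndependent_iff]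
  constructor
  · intro h c hc
    choose d hd using fun i => residue_surjective (R := R) (c i)
    have h1 : ∀ k, q ∣ ∑ i, d i * g i k := by
      intro k
      rw [← aux_res_dvd hmax]
      have := congrFun hc k
      simpa [hd] using this
    have h2 := h (fun i => q ^ (n - 1) * d i) (by
      funext k
      obtain ⟨e, he⟩ := h1 k
      have : ∑ i, q ^ (n - 1) * d i * g i k = q ^ (n - 1) * ∑ i, d i * g i k := by
        rw [Finset.mul_sum]; simp [mul_assoc]
      simp only [Finset.sum_apply, Pi.smul_apply, smul_eq_mul, Pi.zero_apply]
      rw [this, he, ← mul_assoc, ← pow_succ, Nat.sub_add_cancel hn, hq, zero_mul])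
    intro i
    rw [← hd]
    exact aux_tors hq1 (by omega) (h2 i)
  · intro h c hc
    have key : ∀ j, j ≤ n → ∃ d : ι → R, ∀ i, c i = q ^ j * d i := by
      intro j
      induction j with
      | zero => intro _; exact ⟨c, by simp⟩
      | succ j ih =>
        intro hj
        obtain ⟨d, hd⟩ := ih (by omega)
        have h3 : ∀ i, residue R (d i) = 0 := by
          apply h
          funext k
          have h4 : q ^ j * ∑ i, d i * g i k = 0 := by
            rw [Finset.mul_sum]
            have := congrFun hc k
            simpa [hd, mul_assoc] using this
          simpa using aux_tors hq1 (by omega) h4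
        choose e he using fun i => (aux_res_dvd hmax (d i)).1 (h3 i)
        exact ⟨e, fun i => by rw [hd, he]; ring⟩
    obtain ⟨d, hd⟩ := key n le_rfl
    intro i
    rw [hd, hq, zero_mul]

theorem aux_field1 {k : Type*} [Field k] {m : ℕ} (b : Fin m → Fin (m + 1) → k)
    (hb : LinearIndependent k b) (w x : Fin (m + 1) → k) (hw0 : w ≠ 0)
    (hw : ∀ i, b i ⬝ᵥ w = 0) (hx : ∀ i, b i ⬝ᵥ x = 0) : ∃ c : k, x = c • w := by
  have hr : (Matrix.of b).rank = m := by
    simpa using LinearIndependent.rank_matrix (M := Matrix.of b) hb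
  have h1 := (Matrix.of b).mulVecLin.finrank_range_add_finrank_ker
  have h2 : Module.finrank k (LinearMap.ker (Matrix.of b).mulVecLin) = 1 := by
    unfold Matrix.rank at hr
    rw [hr] at h1
    simp at h1
    omega
  have hwk : w ∈ LinearMap.ker (Matrix.of b).mulVecLin := by
    rw [LinearMap.mem_ker]; funext i; exact hw i
  have hxk : x ∈ LinearMap.ker (Matrix.of b).mulVecLin := by
    rw [LinearMap.mem_ker]; funext i; exact hx i
  obtain ⟨c, hc⟩ := (finrank_eq_one_iff_of_nonzero' (⟨w, hwk⟩ : LinearMap.ker _)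
    (by simpa [Subtype.ext_iff] using hw0)).1 h2 ⟨x, hxk⟩
  exact ⟨c, by simpa using (congrArg Subtype.val hc).symm⟩

theorem aux_field2 {k : Type*} [Field k] {m : ℕ} {ι : Type*} [Finite ι]
    (b : ι → Fin (m + 1) → k) (w : Fin (m + 1) → k)
    (hx : ∀ x, (∀ i, b i ⬝ᵥ x = 0) → ∃ c : k, x = c • w) :
    ∃ t : Fin m → ι, LinearIndependent k (fun i => b (t i)) := by
  cases nonempty_fintype ι
  have h1 := (Matrix.of b).mulVecLin.finrank_range_add_finrank_ker
  have h2 : Module.finrank k (LinearMap.ker (Matrix.of b).mulVecLin) ≤ 1 := by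
    have hle : LinearMap.ker (Matrix.of b).mulVecLin ≤ Submodule.span k {w} := by
      intro x hxk
      obtain ⟨c, hc⟩ := hx x (fun i => congrFun (LinearMap.mem_ker.1 hxk) i)
      rw [hc]
      exact Submodule.smul_mem _ _ (Submodule.mem_span_singleton_self w)
    refine (Submodule.finrank_mono hle).trans ?_
    simpa using finrank_span_le_card (R := k) ({w} : Set (Fin (m + 1) → k))
  have h3 := (Matrix.of b).rank_eq_finrank_span_row
  have h4 : m ≤ Module.finrank k (Submodule.span k (Set.range b)) := by
    have : Module.finrank k (Submodule.span k (Set.range b)) = (Matrix.of b).rank := h3.symm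
    rw [this]
    unfold Matrix.rank
    simp at h1
    omega
  obtain ⟨f, hf, -, hli⟩ := Submodule.exists_fun_fin_finrank_span_eq k (Set.range b)
  choose t ht using hf
  refine ⟨fun i => t (Fin.castLE h4 i), ?_⟩
  simp only [ht]
  exact hli.comp _ (Fin.castLE_injective h4)

open IsLocalRing in
theorem aux_res_dot {R : Type*} [CommRing R] [IsLocalRing R] {κ : Type*} [Fintype κ]
    (x y : κ → R) :
    (fun k => residue R (x k)) ⬝ᵥ (fun k => residue R (y k)) = residue R (x ⬝ᵥ y) := by
  simp [dotProduct]

open IsLocalRing in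
theorem aux_main {R : Type*} [CommRing R] [IsLocalRing R] {q : R} {n : ℕ} (hn : 1 ≤ n)
    (hmax : maximalIdeal R = Ideal.span {q}) (hq : q ^ n = 0)
    (hq1 : q ^ (n - 1) ≠ 0) {m : ℕ} {ι : Type*} [Finite ι] (g : ι → Fin (m + 1) → R)
    (w : Fin (m + 1) → R) (hw : ∀ i, g i ⬝ᵥ w = 0) (hroot : ∀ r : R, r ≠ 0 → r • w ≠ 0) :
    (∀ u, (∀ i, g i ⬝ᵥ u = 0) → ∃ a : R, u = a • w) ↔
      ∃ t : Fin m → ι, LinearIndependent R (fun i => g (t i)) := by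
  constructor
  · intro h
    obtain ⟨t, ht⟩ := aux_field2 (fun i k => residue R (g i k)) (fun k => residue R (w k)) (by
      intro x hx
      choose u hu using fun k => residue_surjective (R := R) (x k)
      obtain rfl : (fun k => residue R (u k)) = x := funext hu
      obtain ⟨a, ha⟩ := h (q ^ (n - 1) • u) (by
        intro i
        have := hx i
        rw [aux_res_dot, aux_res_dvd hmax] at this
        obtain ⟨e, he⟩ := this
        rw [dotProduct_smul, he, smul_eq_mul, ← mul_assoc, ← pow_succ,
          Nat.sub_add_cancel hn, hq, zero_mul])
      have hqa : q * a = 0 := by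
        by_contra hne
        apply hroot _ hne
        rw [mul_smul, ← ha, smul_smul, ← pow_succ', Nat.sub_add_cancel hn, hq, zero_smul]
      obtain ⟨b, rfl⟩ := aux_ann hmax hq1 hqa (n - 1) (by omega)
      refine ⟨residue R b, ?_⟩
      funext k
      have h5 : q ^ (n - 1) * (u k - b * w k) = 0 := by
        have := congrFun ha k
        simp only [Pi.smul_apply, smul_eq_mul] at this
        rw [mul_sub, this]; ring
      have := aux_tors hq1 (by omega) h5
      rw [map_sub, map_mul, sub_eq_zero] at this
      simpa using this)
    exact ⟨t, (aux_li_iff hn hmax hq hq1 (fun i => g (t i))).2 ht⟩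
  · rintro ⟨t, ht⟩ u hu
    rw [aux_li_iff hn hmax hq hq1] at ht
    have hw0 : (fun k => residue R (w k)) ≠ 0 := by
      intro h0
      apply hroot _ hq1
      funext k
      obtain ⟨e, he⟩ := (aux_res_dvd hmax (w k)).1 (congrFun h0 k)
      simp only [Pi.smul_apply, smul_eq_mul, Pi.zero_apply]
      rw [he, ← mul_assoc, ← pow_succ, Nat.sub_add_cancel hn, hq, zero_mul]
    have key : ∀ d j, j + d = n → ∀ u, (∀ i, q ^ j * (g (t i) ⬝ᵥ u) = 0) →
        ∃ a : R, q ^ j • u = a • w := by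
      intro d
      induction d with
      | zero => rintro j rfl u -; exact ⟨0, by simp [show q ^ j = 0 from hq]⟩
      | succ d ih =>
        intro j hj u hu
        obtain ⟨c, hc⟩ := aux_field1 _ ht (fun k => residue R (w k)) (fun k => residue R (u k)) hw0
          (fun i => by rw [aux_res_dot, hw, map_zero])
          (fun i => by rw [aux_res_dot]; exact aux_tors hq1 (by omega) (hu i))
        obtain ⟨b, rfl⟩ := residue_surjective c
        have : ∀ k, q ∣ u k - b * w k := by
          intro k
          rw [← aux_res_dvd hmax, map_sub, map_mul, sub_eq_zero]
          exact congrFun hc k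
        choose u1 hu1 using this
        have hu2 : u = b • w + q • u1 := by
          funext k
          simp [← hu1]
        obtain ⟨a, ha⟩ := ih (j + 1) (by omega) u1 (by
          intro i
          have := hu i
          rw [hu2, dotProduct_add, dotProduct_smul, dotProduct_smul, hw] at this
          rw [← this, smul_eq_mul, smul_eq_mul]; ring)
        refine ⟨q ^ j * b + a, ?_⟩
        rw [hu2, smul_add, add_smul, ← ha, smul_smul, smul_smul, pow_succ]
    obtain ⟨a, ha⟩ := key n 0 (by simp) u (fun i => by simp [hu])
    exact ⟨a, by simpa using ha⟩

theorem aux_cons_dot {R : Type*} [CommRing R] {m : ℕ} (a b : R) (x y : Fin m → R) :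
    (Fin.cons a x : Fin (m + 1) → R) ⬝ᵥ (Fin.cons b y : Fin (m + 1) → R) = b * a + dot y x := by
  simp [dotProduct, dot, Fin.sum_univ_succ, mul_comm]

theorem stmt_12
    (R : Type) [CommRing R] [IsLocalRing R] [Fintype R]
    (p n ℓ : ℕ) (hp : p.Prime) (hn : 1 ≤ n)
    (hmax : IsLocalRing.maximalIdeal R = Ideal.span {(p : R)})
    (hpn : (p : R) ^ n = 0) (hpn1 : (p : R) ^ (n - 1) ≠ 0)
    (hres : Nat.card (IsLocalRing.ResidueField R) = p ^ ℓ)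
    (m : ℕ) (hm : 1 ≤ m) (f : (Fin m → R) → R)
    (hinj : Function.Injective fun av : R × (Fin m → R) => cword f av.1 av.2)
    (v : Fin m → R) (hv : v ≠ 0) (hroot : ∀ r : R, r ≠ 0 → r • v ≠ 0) :
    IsMinimalWord (Cf f) (cword f 0 v) ↔
      ∃ β : Fin m → Fin m → R, (∀ i, β i ≠ 0) ∧ (∀ i, dot v (β i) = 0) ∧
        LinearIndependent R fun i => (Fin.cons (f (β i)) (β i) : Fin (m + 1) → R) := by
  have hcz : cword f 0 (0 : Fin m → R) = 0 := by funext x; simp [cword, dot]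
  have hsm : ∀ a : R, a • cword f 0 v = cword f 0 (a • v) := by
    intro a; funext x
    simp [cword, dot, Finset.mul_sum, mul_assoc]
  have hne : cword f 0 v ≠ 0 := by
    intro h
    rw [← hcz] at h
    have := @hinj (0, v) (0, 0) h
    exact hv (Prod.ext_iff.1 this).2
  have hsmc : ∀ a : R, a • (Fin.cons 0 v : Fin (m + 1) → R) = Fin.cons 0 (a • v) := by
    intro a; funext k
    refine Fin.cases ?_ (fun k => ?_) k <;> simp
  have hM := aux_main hn hmax hpn hpn1
    (ι := {x : Fin m → R // x ≠ 0 ∧ dot v x = 0})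
    (fun x => (Fin.cons (f x.1) x.1 : Fin (m + 1) → R)) (Fin.cons 0 v)
    (fun x => by rw [aux_cons_dot, x.2.2]; simp)
    (fun r hr h => hroot r hr (by
      rw [hsmc] at h
      funext k
      simpa using congrFun h k.succ))
  have h1 : IsMinimalWord (Cf f) (cword f 0 v) ↔
      (∀ u : Fin (m + 1) → R, (∀ i : {x : Fin m → R // x ≠ 0 ∧ dot v x = 0},
        (Fin.cons (f i.1) i.1 : Fin (m + 1) → R) ⬝ᵥ u = 0) →
        ∃ a : R, u = a • (Fin.cons 0 v : Fin (m + 1) → R)) := by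
    constructor
    · rintro ⟨-, h⟩ u hu
      rw [← Fin.cons_self_tail u] at hu ⊢
      obtain ⟨a, ha⟩ := h (cword f (u 0) (Fin.tail u)) ⟨_, _, rfl⟩ (by
        intro i hi hi0
        apply hi
        have := hu ⟨i.1, i.2, by simpa [cword] using hi0⟩
        rwa [aux_cons_dot] at this)
      rw [hsm] at ha
      have := @hinj (u 0, Fin.tail u) (0, a • v) ha
      rw [Prod.mk.injEq] at this
      refine ⟨a, ?_⟩
      rw [hsmc, this.1, this.2]
    · intro h
      refine ⟨hne, ?_⟩
      rintro c' ⟨b, u, rfl⟩ hs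
      obtain ⟨a, ha⟩ := h (Fin.cons b u) (by
        rintro ⟨x, hx0, hx⟩
        rw [aux_cons_dot]
        by_contra hcon
        exact hs ⟨x, hx0⟩ hcon (by simpa [cword] using hx))
      rw [hsmc] at ha
      refine ⟨a, ?_⟩
      obtain ⟨hb, hu⟩ := Fin.cons_inj.1 ha
      rw [hsm, hb, hu]
  rw [h1, hM]
  constructor
  · rintro ⟨t, ht⟩
    exact ⟨fun i => (t i).1, fun i => (t i).2.1, fun i => (t i).2.2, ht⟩
  · rintro ⟨β, hb0, hbv, hli⟩
    exact ⟨fun i => ⟨β i, hb0 i, hbv i⟩, hli⟩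
end

section
/- Let m ≥ 1, let f : R^m → R be a function, and assume that the map (a,v) ↦ c(a,v) defining C_f is injective. Let d = p^r·u be a zero divisor of R with u a unit and 1 ≤ r ≤ n−1, let v ∈ R^m be a nonzero root word, and set w = −u^(−1)·v. Then the codeword c(d, v) is a minimal codeword of C_f if and only if there exist nonzero vectors β_1, …, β_m ∈ R^m such that the vectors α_{β_1} = (f(β_1), β_1), …, α_{β_m} = (f(β_m), β_m) are R-linearly independent in R^(m+1) and p^r·f(β_i) = w·β_i for all 1 ≤ i ≤ m. -/
theorem aux_cword {R : Type} [CommRing R] {m : ℕ} (f : (Fin m → R) → R) (a : R) (v : Fin m → R)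
    (x : {x : Fin m → R // x ≠ 0}) :
    cword f a v x = dot (Fin.cons a v : Fin (m+1) → R) (Fin.cons (f x.1) x.1 : Fin (m+1) → R) := by
  simp [cword, dot, Fin.sum_univ_succ]

theorem aux_orth_le {R : Type} [CommRing R] [Fintype R] {N : ℕ} (V : Fin (N+1) → R) (j : Fin (N+1))
    (hj : IsUnit (V j)) (A : Fin N → Fin (N+1) → R) (hA : LinearIndependent R A)
    (hVA : ∀ i, dot V (A i) = 0) : orth V = Submodule.span R (Set.range A) := by
  classical
  have hle : Submodule.span R (Set.range A) ≤ orth V := by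
    rw [Submodule.span_le]
    rintro _ ⟨i, rfl⟩
    exact hVA i
  have hsurj : Function.Surjective (dotLin V) := by
    intro c
    obtain ⟨w, hw⟩ := hj
    refine ⟨Pi.single j ((↑w⁻¹ : R) * c), ?_⟩
    change dot V _ = c
    simp [dot, Pi.single_apply, ← hw]
  have hposR : 0 < Nat.card R := Nat.card_pos
  have hker : Nat.card (orth V) * Nat.card R = Nat.card R ^ (N+1) := by
    have h1 := Submodule.card_eq_card_quotient_mul_card (orth V)
    have h2 : Nat.card ((Fin (N+1) → R) ⧸ orth V) = Nat.card R :=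
      Nat.card_congr ((dotLin V).quotKerEquivOfSurjective hsurj).toEquiv
    rw [h2] at h1
    rw [mul_comm]
    rw [mul_comm] at h1
    simp only [Nat.card_fun, Nat.card_fin] at h1
    rw [h1, mul_comm]
  have hspan : Nat.card (Submodule.span R (Set.range A)) = Nat.card R ^ N := by
    have h := Nat.card_congr hA.linearCombinationEquiv.toEquiv
    rw [← h, Nat.card_congr (Finsupp.equivFunOnFinite (α := Fin N) (M := R))]
    simp
  have hcard : Nat.card (orth V) = Nat.card R ^ N := by
    rw [pow_succ] at hker
    exact Nat.eq_of_mul_eq_mul_right hposR hker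
  symm
  apply SetLike.coe_injective
  apply Set.eq_of_subset_of_ncard_le hle _ (Set.toFinite _)
  change Nat.card (orth V) ≤ Nat.card (Submodule.span R (Set.range A))
  rw [hcard, hspan]

theorem aux_mult {R : Type} [CommRing R] {N : ℕ} (V W : Fin N → R) (j : Fin N)
    (w : Rˣ) (hj : (w : R) = V j) (h : ∀ x, dot V x = 0 → dot W x = 0) :
    ∃ a : R, W = a • V := by
  classical
  refine ⟨(↑w⁻¹ : R) * W j, ?_⟩
  funext k
  have h1 := h (Pi.single k 1 - Pi.single j ((↑w⁻¹ : R) * V k)) (by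
    simp [dot, Pi.single_apply, mul_sub, Finset.sum_sub_distrib, ← hj])
  simp [dot, Pi.single_apply, mul_sub, Finset.sum_sub_distrib] at h1
  simp only [Pi.smul_apply, smul_eq_mul]
  linear_combination h1

theorem aux_residue {R : Type} [CommRing R] [IsLocalRing R] (p : ℕ)
    (hmax : IsLocalRing.maximalIdeal R = Ideal.span {(p : R)}) (x : R) :
    IsLocalRing.residue R x = 0 ↔ ∃ y, x = p * y := by
  rw [IsLocalRing.residue_eq_zero_iff, hmax, Ideal.mem_span_singleton]
  rfl

theorem aux_kill {R : Type} [CommRing R] [IsLocalRing R] (p n : ℕ)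
    (hpn1 : (p : R) ^ (n - 1) ≠ 0) (s : ℕ) (hs : s < n) (x : R)
    (hx : (p : R) ^ s * x = 0) : IsLocalRing.residue R x = 0 := by
  by_contra h
  rw [IsLocalRing.residue_eq_zero_iff, IsLocalRing.mem_maximalIdeal, mem_nonunits_iff, not_not] at h
  have h2 : (p : R) ^ s = 0 := (h.mul_left_eq_zero).1 hx
  apply hpn1
  obtain ⟨t, ht⟩ := Nat.exists_eq_add_of_le (Nat.le_sub_one_of_lt hs)
  rw [ht, pow_add, h2, zero_mul]

theorem aux_linInd {R : Type} [CommRing R] [IsLocalRing R] (p n : ℕ)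
    (hmax : IsLocalRing.maximalIdeal R = Ideal.span {(p : R)})
    (hpn : (p : R) ^ n = 0) (hpn1 : (p : R) ^ (n - 1) ≠ 0) {N M : ℕ} (A : Fin N → Fin M → R)
    (hA : LinearIndependent (IsLocalRing.ResidueField R)
      fun i => (fun k => IsLocalRing.residue R (A i k))) : LinearIndependent R A := by
  rw [Fintype.linearIndependent_iff] at hA ⊢
  intro c hc
  have key : ∀ s ≤ n, ∃ c' : Fin N → R, ∀ i, c i = (p : R) ^ s * c' i := by
    intro s
    induction s with
    | zero => intro _; exact ⟨c, by simp⟩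
    | succ s ih =>
      intro hs
      obtain ⟨c', hc'⟩ := ih (by omega)
      have h0 : ∀ i, IsLocalRing.residue R (c' i) = 0 := by
        apply hA
        funext k
        have h1 := aux_kill p n hpn1 s (by omega) (∑ i, c' i * A i k) (by
          have := congrFun hc k
          simp only [Finset.sum_apply, Pi.smul_apply, smul_eq_mul, Pi.zero_apply, hc'] at this
          rw [Finset.mul_sum, ← this]
          exact Finset.sum_congr rfl fun i _ => by ring)
        simpa [map_sum] using h1
      choose d hd using fun i => (aux_residue p hmax _).1 (h0 i)
      exact ⟨d, fun i => by rw [hc', hd]; ring⟩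
  obtain ⟨c', hc'⟩ := key n le_rfl
  intro i
  rw [hc', hpn, zero_mul]

theorem aux_field {k : Type} [Field k] {N : ℕ} (S : Set (Fin (N+1) → k)) (V : Fin (N+1) → k)
    (h : ∀ W : Fin (N+1) → k, (∀ s ∈ S, dot W s = 0) → ∃ a : k, W = a • V) :
    ∃ b : Fin N → Fin (N+1) → k, (∀ i, b i ∈ S) ∧ LinearIndependent k b := by
  classical
  have h1 : (Submodule.span k S).dualAnnihilator ≤ Submodule.span k {dotLin V} := by
    intro φ hφ
    rw [Submodule.mem_dualAnnihilator] at hφ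
    have hrep : ∀ x, φ x = dot (fun i => φ (Pi.single i 1)) x := by
      intro x
      conv_lhs => rw [pi_eq_sum_univ' x]
      simp only [map_sum, map_smul, smul_eq_mul, dot]
      refine Finset.sum_congr rfl fun i _ => ?_
      rw [mul_comm]
    obtain ⟨a, ha⟩ := h (fun i => φ (Pi.single i 1)) (fun s hs => by
      rw [← hrep]; exact hφ s (Submodule.subset_span hs))
    rw [Submodule.mem_span_singleton]
    refine ⟨a, ?_⟩
    ext1
    refine LinearMap.ext fun x => ?_
    simp only [LinearMap.comp_apply]
    rw [hrep, ha]
    simp [dotLin, dot, Finset.mul_sum, mul_assoc]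
  have h2 := Submodule.finrank_mono h1
  have h3 : Module.finrank k (Submodule.span k {dotLin V}) ≤ 1 :=
    (finrank_span_le_card _).trans (by simp)
  have h23 : Module.finrank k (Submodule.span k S).dualAnnihilator ≤ 1 := h2.trans h3
  have h4 := Subspace.finrank_add_finrank_dualAnnihilator_eq (Submodule.span k S)
  rw [Module.finrank_fin_fun] at h4
  obtain ⟨b, hbS, hbspan, hb⟩ := exists_linearIndependent k S
  have hfin : b.Finite := hb.setFinite
  haveI := hfin.fintype
  have h5 : Module.finrank k (Submodule.span k b) = Fintype.card b := by
    have := finrank_span_eq_card hb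
    rwa [Subtype.range_coe] at this
  rw [hbspan] at h5
  have h6 : Fintype.card (Fin N) ≤ Fintype.card b := by simp only [Fintype.card_fin]; omega
  obtain ⟨e⟩ := Function.Embedding.nonempty_of_card_le h6
  exact ⟨fun i => (e i : Fin (N+1) → k), fun i => hbS (e i).2, hb.comp e e.injective⟩

theorem stmt_13
    (R : Type) [CommRing R] [IsLocalRing R] [Fintype R]
    (p n ℓ : ℕ) (hp : p.Prime) (hn : 1 ≤ n)
    (hmax : IsLocalRing.maximalIdeal R = Ideal.span {(p : R)})
    (hpn : (p : R) ^ n = 0) (hpn1 : (p : R) ^ (n - 1) ≠ 0)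
    (hres : Nat.card (IsLocalRing.ResidueField R) = p ^ ℓ)
    (m : ℕ) (hm : 1 ≤ m) (f : (Fin m → R) → R)
    (hinj : Function.Injective fun av : R × (Fin m → R) => cword f av.1 av.2)
    (r : ℕ) (hr1 : 1 ≤ r) (hr2 : r ≤ n - 1) (u : Rˣ)
    (v : Fin m → R) (hv : v ≠ 0) (hroot : ∀ s : R, s ≠ 0 → s • v ≠ 0) :
    IsMinimalWord (Cf f) (cword f ((p : R) ^ r * (u : R)) v) ↔
      ∃ β : Fin m → Fin m → R, (∀ i, β i ≠ 0) ∧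
        (LinearIndependent R fun i => (Fin.cons (f (β i)) (β i) : Fin (m + 1) → R)) ∧
        ∀ i, (p : R) ^ r * f (β i) = dot (-((↑u⁻¹ : R) • v)) (β i) := by
  classical
  set d : R := (p : R) ^ r * (u : R) with hd
  set V : Fin (m+1) → R := Fin.cons d v with hVdef
  -- some coordinate of `v` is a unit
  have hunit : ∃ j, IsUnit (v j) := by
    by_contra hcon
    push Not at hcon
    apply hroot _ hpn1
    funext j
    have : IsLocalRing.residue R (v j) = 0 := by
      rw [IsLocalRing.residue_eq_zero_iff, IsLocalRing.mem_maximalIdeal]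
      exact hcon j
    obtain ⟨y, hy⟩ := (aux_residue p hmax _).1 this
    simp only [Pi.smul_apply, smul_eq_mul, Pi.zero_apply]
    rw [hy, ← mul_assoc, ← pow_succ, Nat.sub_add_cancel hn, hpn, zero_mul]
  obtain ⟨j, w, hw⟩ := hunit
  have hVj : (w : R) = V j.succ := by simp [hVdef, hw]
  -- the condition on `β`
  have hcond : ∀ x : Fin m → R, (p : R) ^ r * f x = dot (-((↑u⁻¹ : R) • v)) x ↔
      dot V (Fin.cons (f x) x : Fin (m+1) → R) = 0 := by
    intro x
    have h1 : dot (-((↑u⁻¹ : R) • v)) x = - ((↑u⁻¹ : R) * dot v x) := by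
      simp [dot, Finset.mul_sum, mul_assoc]
    have h2 : dot V (Fin.cons (f x) x : Fin (m+1) → R) = (p : R) ^ r * u * f x + dot v x := by
      simp [dot, Fin.sum_univ_succ, hVdef, hd]
    rw [h1, h2]
    have hu : (u : R) * (↑u⁻¹ : R) = 1 := u.mul_inv
    constructor
    · intro h
      linear_combination (u : R) * h - dot v x * hu
    · intro h
      linear_combination (↑u⁻¹ : R) * h - (p : R) ^ r * f x * hu
  have hsmul : ∀ (a : R), a • cword f d v = cword f (a * d) (a • v) := by
    intro a
    funext x
    simp [cword, dot, Finset.mul_sum, mul_add, mul_assoc]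
  constructor
  · rintro ⟨-, hmin⟩
    -- words orthogonal to `S` are multiples of `V`
    have hmult : ∀ W : Fin (m+1) → R,
        (∀ x : Fin m → R, x ≠ 0 → dot V (Fin.cons (f x) x : Fin (m+1) → R) = 0 →
          dot W (Fin.cons (f x) x : Fin (m+1) → R) = 0) → ∃ a : R, W = a • V := by
      intro W hW
      obtain ⟨a, ha⟩ := hmin (cword f (W 0) (Fin.tail W)) ⟨_, _, rfl⟩ (by
        intro x hx hx0
        apply hx
        rw [aux_cword] at hx0 ⊢
        rw [Fin.cons_self_tail]
        exact hW x.1 x.2 hx0)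
      rw [hsmul] at ha
      have h1 := @hinj (W 0, Fin.tail W) (a * d, a • v) ha
      refine ⟨a, ?_⟩
      rw [Prod.mk.injEq] at h1
      rw [← Fin.cons_self_tail W, h1.1, h1.2]
      funext i
      refine Fin.cases ?_ (fun i => ?_) i <;> simp [hVdef]
    let ρ := IsLocalRing.residue R
    obtain ⟨b, hbS, hb⟩ := aux_field
      (S := {y : Fin (m+1) → IsLocalRing.ResidueField R | ∃ x : Fin m → R, x ≠ 0 ∧
        dot V (Fin.cons (f x) x : Fin (m+1) → R) = 0 ∧
        y = fun k => ρ ((Fin.cons (f x) x : Fin (m+1) → R) k)})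
      (V := fun k => ρ (V k)) (by
        intro W hW
        choose W' hW' using fun k => IsLocalRing.residue_surjective (R := R) (W k)
        obtain ⟨a, ha⟩ := hmult (((p : R) ^ (n-1)) • W') (by
          intro x hx hx0
          have h1 := hW _ ⟨x, hx, hx0, rfl⟩
          have h2 : ρ (dot W' (Fin.cons (f x) x : Fin (m+1) → R)) = 0 := by
            rw [← h1]
            simp only [dot, map_sum, map_mul]
            exact Finset.sum_congr rfl fun k _ => by rw [← hW' k]
          obtain ⟨y, hy⟩ := (aux_residue p hmax _).1 h2
          have h3 : dot (((p : R) ^ (n-1)) • W') (Fin.cons (f x) x : Fin (m+1) → R)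
              = (p : R) ^ (n-1) * dot W' (Fin.cons (f x) x : Fin (m+1) → R) := by
            simp only [dot, Finset.mul_sum, Pi.smul_apply, smul_eq_mul, mul_assoc]
          rw [h3, hy, ← mul_assoc, ← pow_succ, Nat.sub_add_cancel hn, hpn, zero_mul])
        have hwi : (w : R) * (↑w⁻¹ : R) = 1 := w.mul_inv
        have haj := congrFun ha j.succ
        simp only [Pi.smul_apply, smul_eq_mul, ← hVj] at haj
        refine ⟨ρ (W' j.succ * (↑w⁻¹ : R)), ?_⟩
        funext k
        have hak := congrFun ha k
        simp only [Pi.smul_apply, smul_eq_mul] at hak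
        have h4 := aux_kill p n hpn1 (n-1) (by omega)
          (W' k - W' j.succ * (↑w⁻¹ : R) * V k) (by
            linear_combination hak - (↑w⁻¹ : R) * V k * haj - a * V k * hwi)
        rw [map_sub, sub_eq_zero, map_mul, hW'] at h4
        simpa using h4)
    choose β hβ0 hβV hβb using hbS
    refine ⟨β, hβ0, ?_, fun i => (hcond _).2 (hβV i)⟩
    apply aux_linInd p n hmax hpn hpn1
    have : b = fun i => fun k => ρ ((Fin.cons (f (β i)) (β i) : Fin (m+1) → R) k) := by
      funext i
      rw [hβb i]
    rw [← this]
    exact hb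
  · rintro ⟨β, hβ0, hβ, hβV⟩
    have hVβ := fun i => (hcond _).1 (hβV i)
    refine ⟨?_, ?_⟩
    · intro h0
      have h1 := @hinj (d, v) (0, 0) (by
        change cword f d v = cword f 0 0
        rw [h0]
        funext x
        simp [cword, dot])
      exact hv (Prod.mk.inj h1).2
    · rintro _ ⟨a, v', rfl⟩ hsupp
      have hspan := aux_orth_le V j.succ ⟨w, hVj⟩ _ hβ hVβ
      obtain ⟨c, hc⟩ := aux_mult V (Fin.cons a v' : Fin (m+1) → R) j.succ w hVj (by
        intro x hx
        have hx1 : x ∈ orth V := hx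
        rw [hspan] at hx1
        have hle : Submodule.span R (Set.range fun i =>
            (Fin.cons (f (β i)) (β i) : Fin (m+1) → R)) ≤
            orth (Fin.cons a v' : Fin (m+1) → R) := by
          rw [Submodule.span_le]
          rintro _ ⟨i, rfl⟩
          change dot (Fin.cons a v' : Fin (m+1) → R) _ = 0
          by_contra hne
          have := hsupp ⟨β i, hβ0 i⟩ (by rw [aux_cword]; exact hne)
          apply this
          rw [aux_cword]
          exact hVβ i
        exact hle hx1)
      refine ⟨c, ?_⟩
      funext x
      rw [Pi.smul_apply, aux_cword, aux_cword, hc]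
      simp only [dot, Finset.mul_sum, Pi.smul_apply, smul_eq_mul, mul_assoc, hVdef]
end

section
/- Assume q > 3 and m ≥ 3, and let f : R^m → R be a function satisfying the following four conditions: (1) for every x ∈ R^m with 1 ≤ w(x) ≤ 2 and every unit u of R, f(u·x) = f(x) and f(x) is a unit of R; (2) for all root words x, x' ∈ R^m with 1 ≤ w(x) ≤ 2 and 1 ≤ w(x') ≤ 2, if x − x' ∈ pR^m then f(x) = f(x'); (3) for every x ∈ R^m with w(x) = m having at least two unit components, f(x) = 0; (4) for every x ∈ R^m with w(x) = m having exactly one unit component and such that for some r with 1 ≤ r ≤ n−1 every non-unit component of x is of the form p^r·(unit), one has f(x) = p^r. Then C_f is a minimal linear code, i.e., every nonzero codeword of C_f is a minimal codeword. -/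
lemma dot_add_r {R : Type*} [CommRing R] {m : ℕ} (v x y : Fin m → R) :
    dot v (x + y) = dot v x + dot v y := by simp [dot, mul_add, Finset.sum_add_distrib]

lemma dot_smul_r {R : Type*} [CommRing R] {m : ℕ} (v x : Fin m → R) (c : R) :
    dot v (c • x) = c * dot v x := by simp [dot, Finset.mul_sum, mul_left_comm]

lemma dot_lin_l {R : Type*} [CommRing R] {m : ℕ} (v w z : Fin m → R) (c d : R)
    (h : ∀ j, z j = c * v j + d * w j) (x : Fin m → R) :
    dot z x = c * dot v x + d * dot w x := by
  simp only [dot, Finset.mul_sum, ← Finset.sum_add_distrib]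
  exact Finset.sum_congr rfl fun j _ => by rw [h]; ring

lemma dot_single {R : Type*} [CommRing R] {m : ℕ} (v : Fin m → R) (i : Fin m) (c : R) :
    dot v (Pi.single i c) = v i * c := by
  simp only [dot]
  rw [Finset.sum_eq_single i]
  · simp
  · intro j _ hj; simp [hj]
  · simp

lemma dot_update {R : Type*} [CommRing R] {m : ℕ} (v u : Fin m → R) (i : Fin m) (t : R) :
    dot v (Function.update u i t) = dot v u + v i * (t - u i) := by
  have : Function.update u i t = u + Pi.single i (t - u i) := by
    funext j
    by_cases h : j = i
    · subst h; simp
    · simp [h]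
  rw [this, dot_add_r, dot_single]

/-- The vector `c e_i + d e_j`. -/
def pr {R : Type*} [CommRing R] {m : ℕ} (i j : Fin m) (c d : R) : Fin m → R :=
  Pi.single i c + Pi.single j d

lemma dot_pr {R : Type*} [CommRing R] {m : ℕ} (v : Fin m → R) (i j : Fin m) (c d : R) :
    dot v (pr i j c d) = v i * c + v j * d := by
  rw [pr, dot_add_r, dot_single, dot_single]

lemma pr_left {R : Type*} [CommRing R] {m : ℕ} {i j : Fin m} (h : j ≠ i) (c d : R) :
    pr i j c d i = c := by simp [pr, h.symm]

lemma pr_right {R : Type*} [CommRing R] {m : ℕ} {i j : Fin m} (h : j ≠ i) (c d : R) :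
    pr i j c d j = d := by simp [pr, h]

lemma pr_other {R : Type*} [CommRing R] {m : ℕ} {i j l : Fin m} (h : l ≠ i) (h' : l ≠ j)
    (c d : R) : pr i j c d l = 0 := by simp [pr, h, h']

lemma smul_pr {R : Type*} [CommRing R] {m : ℕ} (i j : Fin m) (c d e : R) :
    e • pr i j c d = pr i j (e * c) (e * d) := by
  funext l
  simp only [pr, Pi.smul_apply, Pi.add_apply, Pi.single_apply, smul_eq_mul]
  split_ifs <;> ring

lemma wt_pr {R : Type*} [CommRing R] {m : ℕ} (i j : Fin m) (c d : R) :
    wt (pr i j c d) ≤ 2 := by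
  have : {l | pr i j c d l ≠ 0} ⊆ ({i, j} : Set (Fin m)) := by
    intro l hl
    by_contra h
    simp only [Set.mem_insert_iff, Set.mem_singleton_iff, not_or] at h
    exact hl (pr_other h.1 h.2 c d)
  exact (Set.ncard_le_ncard this (Set.toFinite _)).trans (by have h := Set.ncard_insert_le i ({j} : Set (Fin m)); rw [Set.ncard_singleton] at h; exact h)

lemma wt_pos {R : Type*} [Zero R] {m : ℕ} (x : Fin m → R) (i : Fin m) (h : x i ≠ 0) :
    1 ≤ wt x :=
  (Set.ncard_pos (Set.toFinite _)).2 ⟨i, h⟩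

lemma wt_full {R : Type*} [Zero R] {m : ℕ} (x : Fin m → R) (h : ∀ i, x i ≠ 0) :
    wt x = m := by
  have : {i | x i ≠ 0} = Set.univ := by ext i; simp [h i]
  simp [wt, this, Set.ncard_univ]

/-- The working hypotheses. -/
structure Ctx {R : Type} [CommRing R] [IsLocalRing R] (π : R) (n m : ℕ)
    (f : (Fin m → R) → R) : Prop where
  hm : 3 ≤ m
  pn : π ^ n = 0
  pn1 : ∀ k, k < n → π ^ k ≠ 0
  nu : ¬ IsUnit π
  dv : ∀ x : R, ¬ IsUnit x → π ∣ x
  eps : ∃ e : R, IsUnit e ∧ IsUnit (e - 1)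
  inv : ∀ (i j : Fin m) (c d e : R), pr i j c d ≠ 0 → IsUnit e →
    f (pr i j (e * c) (e * d)) = f (pr i j c d)
  un : ∀ (i j : Fin m) (c d : R), pr i j c d ≠ 0 → IsUnit (f (pr i j c d))
  cg : ∀ (i j : Fin m) (b b' : R), j ≠ i → π ∣ b - b' → f (pr i j b 1) = f (pr i j b' 1)
  two : ∀ x : Fin m → R, (∀ i, x i ≠ 0) → ∀ i, (∀ j, j ≠ i → IsUnit (x j)) → f x = 0
  one : ∀ x : Fin m → R, ∀ r, 1 ≤ r → r < n → ∀ i, IsUnit (x i) →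
    (∀ j, j ≠ i → ∃ u, IsUnit u ∧ x j = π ^ r * u) → f x = π ^ r

section
variable {R : Type} [CommRing R] [IsLocalRing R] {π : R} {n m : ℕ} {f : (Fin m → R) → R}

lemma Ctx.exj (C : Ctx π n m f) (i : Fin m) : ∃ j : Fin m, j ≠ i := by
  have := C.hm
  haveI : Nontrivial (Fin m) := Fin.nontrivial_iff_two_le.2 (by omega)
  exact exists_ne i

lemma Ctx.unadd (C : Ctx π n m f) {u : R} (hu : IsUnit u) (x : R) (h : π ∣ x) :
    IsUnit (u + x) := by
  by_contra hc
  have hx : x ∈ nonunits R := fun hx => C.nu (isUnit_of_dvd_unit h hx)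
  have : u + x + -x ∈ nonunits R := IsLocalRing.nonunits_add hc (by simpa using hx)
  exact this (by simpa using hu)

lemma Ctx.decomp (C : Ctx π n m f) {ι : Type} (w : ι → R) (hw : w ≠ 0) :
    ∃ s, ∃ w0 : ι → R, (∀ i, w i = π ^ s * w0 i) ∧ ∃ i, IsUnit (w0 i) := by
  by_contra hc
  push Not at hc
  have key : ∀ s, ∃ w0 : ι → R, ∀ i, w i = π ^ s * w0 i := by
    intro s
    induction s with
    | zero => exact ⟨w, by simp⟩
    | succ s ih =>
      obtain ⟨w0, h0⟩ := ih
      have h1 := fun i => C.dv _ (hc s w0 h0 i)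
      choose w1 h1 using h1
      exact ⟨w1, fun i => by rw [h0, h1]; ring⟩
  obtain ⟨w0, h0⟩ := key n
  exact hw (funext fun i => by rw [h0, C.pn]; simp)

lemma Ctx.plt (C : Ctx π n m f) {s : ℕ} (h : π ^ s ≠ 0) : s < n := by
  by_contra hc
  exact h (pow_eq_zero_of_le (not_lt.1 hc) C.pn)

lemma Ctx.ann (C : Ctx π n m f) {s k : ℕ} (hn : n = s + k) {b : R} (h : b * π ^ k = 0) :
    ∃ b', b = b' * π ^ s := by
  by_cases hb : b = 0
  · exact ⟨0, by simp [hb]⟩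
  obtain ⟨r, w, hw, ⟨⟩, hu⟩ := C.decomp (fun _ : Unit => b) (fun h => hb (congrFun h ()))
  have hw := hw ()
  have : s ≤ r := by
    by_contra hc
    apply C.pn1 (r + k) (by omega)
    have : w () * π ^ (r + k) = 0 := by rw [← h, hw]; ring
    exact (hu.mul_right_eq_zero).1 this
  obtain ⟨d, rfl⟩ := Nat.exists_eq_add_of_le this
  exact ⟨π ^ d * w (), by rw [hw]; ring⟩

lemma Ctx.zero_of (C : Ctx π n m f) (z : Fin m → R)
    (h : ∀ u : Fin m → R, (∀ j, IsUnit (u j)) → dot z u = 0) (j : Fin m) : z j = 0 := by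
  obtain ⟨e, he, he1⟩ := C.eps
  have h1 := h (fun _ => 1) (fun _ => isUnit_one)
  have h2 := h (Function.update (fun _ => 1) j e) (fun l => by
    by_cases hl : l = j
    · subst hl; simpa using he
    · simp [hl])
  rw [dot_update, h1, zero_add] at h2
  exact (he1.mul_left_eq_zero).1 h2

lemma ne_of_unit {x : Fin m → R} {i : Fin m} (h : IsUnit (x i)) : x ≠ 0 := by
  rintro rfl; simp at h

lemma pr_ne {i j : Fin m} (hj : j ≠ i) {c d : R} (h : c ≠ 0 ∨ d ≠ 0) : pr i j c d ≠ 0 := by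
  intro h0
  have h1 := congrFun h0 i
  have h2 := congrFun h0 j
  rw [pr_left hj] at h1
  rw [pr_right hj] at h2
  rcases h with h | h
  · exact h h1
  · exact h h2

lemma caseA (C : Ctx π n m f) {s k : ℕ} (hn : n = s + k) (v0 v' : Fin m → R) (a' : R)
    (i : Fin m) (hi : IsUnit (v0 i))
    (H : ∀ x ≠ 0, π ^ s * dot v0 x = 0 → a' * f x + dot v' x = 0) :
    a' = 0 ∧ ∃ b, (∀ j, v' j = b * v0 j) ∧ b * π ^ k = 0 := by
  obtain ⟨e, he, he1⟩ := C.eps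
  have key : ∀ j, j ≠ i → a' = 0 ∧ v' i * (- v0 j) + v' j * v0 i = 0 := by
    intro j hj
    have hx : pr i j (- v0 j) (v0 i) ≠ 0 := pr_ne hj (Or.inr hi.ne_zero)
    have hx' : pr i j (e * - v0 j) (e * v0 i) ≠ 0 := pr_ne hj (Or.inr (he.mul hi).ne_zero)
    have e1 := H _ hx (by rw [dot_pr]; ring)
    have e2 := H _ hx' (by rw [dot_pr]; ring)
    rw [C.inv i j _ _ e hx he, dot_pr] at e2
    rw [dot_pr] at e1
    have e3 : v' i * (- v0 j) + v' j * v0 i = 0 :=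
      (he1.mul_right_eq_zero).1 (by linear_combination e2 - e1)
    rw [e3, add_zero] at e1
    exact ⟨((C.un i j _ _ hx).mul_left_eq_zero).1 e1, e3⟩
  obtain ⟨j0, hj0⟩ := C.exj i
  have ha := (key j0 hj0).1
  obtain ⟨c, hc⟩ := hi.exists_right_inv
  refine ⟨ha, v' i * c, ?_, ?_⟩
  · intro j
    by_cases hj : j = i
    · subst hj; linear_combination (-v' j) * hc
    · linear_combination c * (key j hj).2 - v' j * hc
  · by_cases hk : π ^ k = 0
    · simp [hk]
    · have := H (pr i j0 (π ^ k) 0) (pr_ne hj0 (Or.inl hk)) (by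
        rw [dot_pr]
        have := C.pn
        rw [hn, pow_add] at this
        linear_combination v0 i * this)
      rw [dot_pr, ha] at this
      linear_combination c * this

lemma caseB1a (C : Ctx π n m f) {s k : ℕ} (hn : n = s + k) (hk : 1 ≤ k) (a0 a' : R)
    (v' : Fin m → R) (ha : IsUnit a0)
    (H : ∀ x ≠ 0, π ^ s * (a0 * f x) = 0 → a' * f x + dot v' x = 0) :
    (∀ j, v' j = 0) ∧ ∃ b, a' = b * a0 ∧ b * π ^ k = 0 := by
  have := C.hm
  let i : Fin m := ⟨0, by omega⟩
  have hv : ∀ j, v' j = 0 := C.zero_of v' fun u hu => by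
    have hf := C.two u (fun l => (hu l).ne_zero) i (fun l _ => hu l)
    have := H u (ne_of_unit (hu i)) (by rw [hf]; simp)
    simpa [hf] using this
  have hd : ∀ x, dot v' x = 0 := fun x => by simp [dot, hv]
  obtain ⟨c, hc⟩ := ha.exists_right_inv
  refine ⟨hv, a' * c, by linear_combination (-a') * hc, ?_⟩
  by_cases hk' : π ^ k = 0
  · simp [hk']
  have hkn := C.plt hk'
  have hxi : Function.update (fun _ : Fin m => π ^ k) i 1 i = 1 := by simp
  have hf := C.one (Function.update (fun _ => π ^ k) i 1) k hk hkn i (by simp)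
    (fun j hj => ⟨1, isUnit_one, by simp [hj]⟩)
  have := H (Function.update (fun _ => π ^ k) i 1)
    (ne_of_unit (i := i) (by rw [hxi]; exact isUnit_one)) (by
    rw [hf]
    have := C.pn
    rw [hn, pow_add] at this
    linear_combination a0 * this)
  rw [hf, hd] at this
  linear_combination c * this

lemma caseB1b (C : Ctx π n m f) {s k : ℕ} (hn : n = s + k) (hk : 1 ≤ k) (a0 a' : R)
    (v0 v' : Fin m → R) (ha : IsUnit a0) (i : Fin m) (hi : IsUnit (v0 i))
    (H : ∀ x ≠ 0, π ^ s * (a0 * f x + dot v0 x) = 0 → a' * f x + dot v' x = 0) :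
    ∃ b, a' = b * a0 ∧ (∀ j, v' j = b * v0 j) ∧ b * π ^ k = 0 := by
  obtain ⟨e, he, he1⟩ := C.eps
  obtain ⟨c, hc⟩ := ha.exists_right_inv
  have key : ∀ j, j ≠ i → ∀ b, IsUnit (v0 i + v0 j * b) →
      v' i + v' j * b = a' * c * (v0 i + v0 j * b) := by
    intro j hj b hb
    have hx : pr i j 1 b ≠ 0 := pr_ne hj (Or.inl one_ne_zero)
    have hfu := C.un i j 1 b hx
    obtain ⟨d, hd⟩ := hb.exists_right_inv
    have hdu : IsUnit d := IsUnit.of_mul_eq_one _ (by rw [mul_comm]; exact hd)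
    set F := f (pr i j 1 b) with hF
    have ht : IsUnit (-(a0 * F * d)) := ((ha.mul hfu).mul hdu).neg
    have hx' : pr i j (-(a0 * F * d) * 1) (-(a0 * F * d) * b) ≠ 0 :=
      pr_ne hj (Or.inl (by rw [mul_one]; exact ht.ne_zero))
    have hf := C.inv i j 1 b _ hx ht
    have := H _ hx' (by
      rw [hf, dot_pr, ← hF]
      linear_combination (-π ^ s * a0 * F) * hd)
    rw [hf, dot_pr, ← hF] at this
    have h0 : (-(a0 * F * d)) * (v' i + v' j * b - a' * c * (v0 i + v0 j * b)) = 0 := by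
      linear_combination this + (a' * F) * (a0 * c * hd + hc)
    linear_combination (ht.mul_right_eq_zero).1 h0
  obtain ⟨j0, hj0⟩ := C.exj i
  have hzi : v' i = a' * c * v0 i := by
    have := key j0 hj0 0 (by simpa using hi)
    simpa using this
  refine ⟨a' * c, by linear_combination (-a') * hc, ?_, ?_⟩
  · intro j
    by_cases hj : j = i
    · rw [hj, hzi]
    have : ∃ b, IsUnit b ∧ IsUnit (v0 i + v0 j * b) := by
      by_contra hcon
      push Not at hcon
      have n1 := hcon 1 isUnit_one
      have n2 := hcon e he
      have hj' : ¬ IsUnit (v0 j) := by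
        intro hvj
        have := IsLocalRing.nonunits_add (a := v0 i + v0 j * e) (b := -(v0 i + v0 j * 1)) n2
          (fun h => n1 ((IsUnit.neg_iff _).1 h))
        apply this
        have h2 := hvj.mul he1
        convert h2 using 1
        ring
      exact n1 (C.unadd hi _ (by simpa using C.dv _ hj'))
    obtain ⟨b, hb, hb'⟩ := this
    have := key j hj b hb'
    have h0 : b * (v' j - a' * c * v0 j) = 0 := by linear_combination this - hzi
    linear_combination (hb.mul_right_eq_zero).1 h0
  · have hx : pr i j0 (1:R) 0 ≠ 0 := pr_ne hj0 (Or.inl one_ne_zero)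
    have hfu := C.un i j0 1 0 hx
    obtain ⟨d, hd⟩ := hi.exists_right_inv
    have hdu : IsUnit d := IsUnit.of_mul_eq_one _ (by rw [mul_comm]; exact hd)
    set F := f (pr i j0 1 0) with hF
    have ht : IsUnit (-(a0 * F * d)) := ((ha.mul hfu).mul hdu).neg
    have ht' : IsUnit (-(a0 * F * d) + π ^ k) := C.unadd ht _ (dvd_pow_self _ (by omega))
    have hf := C.inv i j0 1 0 _ hx ht'
    have hx' : pr i j0 ((-(a0 * F * d) + π ^ k) * 1) ((-(a0 * F * d) + π ^ k) * 0) ≠ 0 :=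
      pr_ne hj0 (Or.inl (by rw [mul_one]; exact ht'.ne_zero))
    have := H _ hx' (by
      rw [hf, dot_pr, ← hF]
      have := C.pn
      rw [hn, pow_add] at this
      linear_combination (-π ^ s * a0 * F) * hd + v0 i * this)
    rw [hf, dot_pr, ← hF, hzi] at this
    have h0 : v0 i * (a' * c * π ^ k) = 0 := by
      linear_combination this + (a' * F) * (a0 * c * hd + hc)
    exact (hi.mul_right_eq_zero).1 h0

lemma caseB1c (C : Ctx π n m f) {s k : ℕ} (hn : n = s + k) (a0 a' : R)
    (y v' : Fin m → R) (ha : IsUnit a0) (i : Fin m) (hi : IsUnit (y i)) (r : ℕ) (hr : 1 ≤ r)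
    (hrk : r < k)
    (H : ∀ x ≠ 0, π ^ s * (a0 * f x + π ^ r * dot y x) = 0 → a' * f x + dot v' x = 0) :
    ∃ b, a' = b * a0 ∧ (∀ j, v' j = b * (π ^ r * y j)) ∧ b * π ^ k = 0 := by
  obtain ⟨e, he, he1⟩ := C.eps
  obtain ⟨c, hc⟩ := ha.exists_right_inv
  obtain ⟨d, hd⟩ := hi.exists_right_inv
  have hdu : IsUnit d := IsUnit.of_mul_eq_one _ (by rw [mul_comm]; exact hd)
  have hrn : r < n := by omega
  obtain ⟨k', rfl⟩ := Nat.exists_eq_add_of_lt hrk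
  obtain ⟨r', rfl⟩ := Nat.exists_eq_add_of_le' hr
  have hpn := C.pn
  rw [hn, pow_add] at hpn
  set b := a' * c with hb
  have hba : a' = b * a0 := by rw [hb]; linear_combination (-a') * hc
  set z : Fin m → R := fun j => v' j - b * (π ^ (r' + 1) * y j) with hz
  have hv' : ∀ x, dot v' x = b * π ^ (r' + 1) * dot y x + 1 * dot z x :=
    dot_lin_l _ _ _ _ _ (fun j => by simp only [hz]; ring)
  -- one-unit words
  have key : ∀ u : Fin m → R, (∀ j, IsUnit (u j)) → ∀ t,
      IsUnit t → π ^ s * (a0 * π ^ (r'+1) + π ^ (r'+1) *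
        (π ^ (r'+1) * dot y u + y i * (t - π ^ (r'+1) * u i))) = 0 →
      b * (a0 * π ^ (r'+1) + π ^ (r'+1) *
        (π ^ (r'+1) * dot y u + y i * (t - π ^ (r'+1) * u i)))
        + (π ^ (r'+1) * dot z u + z i * (t - π ^ (r'+1) * u i)) = 0 := by
    intro u hu t ht h
    have hf := C.one (Function.update (π ^ (r'+1) • u) i t) (r'+1) hr hrn i (by simpa using ht)
      (fun j hj => ⟨u j, hu j, by simp [hj]⟩)
    have := H (Function.update (π ^ (r'+1) • u) i t)
      (ne_of_unit (i := i) (by simpa using ht)) (by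
        rw [hf, dot_update, dot_smul_r]
        simpa using h)
    rw [hf, hv', dot_update, dot_smul_r, dot_update, dot_smul_r, hba] at this
    simp only [Pi.smul_apply, smul_eq_mul] at this
    linear_combination this
  have tu : ∀ q : R, IsUnit (d * (-a0 + π * q)) := fun q =>
    hdu.mul (C.unadd ha.neg _ (dvd_mul_right _ _))
  have key2 : ∀ u : Fin m → R, (∀ j, IsUnit (u j)) →
      π ^ (r'+1) * (y i * dot z u - z i * dot y u) = z i * a0 := by
    intro u hu
    have := key u hu _ (tu (- π ^ r' * (dot y u - y i * u i))) (by
      linear_combination (π ^ s * π ^ (r'+1) * (-a0 - π ^ (r'+1) * (dot y u - y i * u i))) * hd)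
    linear_combination y i * this -
      (y i * b * π ^ (r'+1) + z i) * (-a0 - π ^ (r'+1) * (dot y u - y i * u i)) * hd
  have hzi : z i = 0 := by
    have e1 := key2 (fun _ => 1) (fun _ => isUnit_one)
    have e2 := key2 (e • fun _ => 1) (fun _ => by simpa using he)
    rw [dot_smul_r, dot_smul_r] at e2
    have : ((e - 1) * a0) * z i = 0 := by linear_combination e2 - e * e1
    exact ((he1.mul ha).mul_right_eq_zero).1 this
  have hbk : b * π ^ (r' + 1 + k' + 1) = 0 := by
    have h1 : ∀ l : Fin m, IsUnit ((fun _ => (1 : R)) l) := fun _ => isUnit_one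
    set u : Fin m → R := fun _ => (1 : R) with hu
    have := key u h1 _ (tu (- π ^ r' * (dot y u - y i * u i) + π ^ k')) (by
      linear_combination (π ^ s * π ^ (r'+1) *
        (-a0 - π ^ (r'+1) * (dot y u - y i * u i) + π ^ (k' + 1))) * hd + hpn)
    have e1 := key2 u h1
    rw [hzi] at e1 this
    have e2 := key u h1 _ (tu (- π ^ r' * (dot y u - y i * u i))) (by
      linear_combination (π ^ s * π ^ (r'+1) * (-a0 - π ^ (r'+1) * (dot y u - y i * u i))) * hd)
    rw [hzi] at e2
    linear_combination this - e2 - b * π ^ (r' + 1) * π ^ (k' + 1) * hd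
  have hz0 : ∀ j, z j = 0 := C.zero_of z fun u hu => by
    have hpk : π ^ (k' + 1) ≠ 0 := C.pn1 _ (by omega)
    have : ∃ t q, t ≠ 0 ∧ dot y u + y i * (t - u i) = π ^ (k' + 1) * q := by
      by_cases h0 : u i - d * dot y u = 0
      · refine ⟨u i - d * dot y u + π ^ (k' + 1), y i, by rw [h0, zero_add]; exact hpk, ?_⟩
        linear_combination - dot y u * hd
      · refine ⟨_, 0, h0, ?_⟩
        linear_combination - dot y u * hd
    obtain ⟨t, q, ht, hq⟩ := this
    have hf := C.two (Function.update u i t) (fun l => by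
        by_cases hl : l = i
        · subst hl; simpa using ht
        · simpa [hl] using (hu l).ne_zero) i (fun l hl => by simpa [hl] using hu l)
    obtain ⟨j0, hj0⟩ := C.exj i
    have := H (Function.update u i t) (ne_of_unit (i := j0) (by simpa [hj0] using hu j0)) (by
      rw [hf, dot_update, hq]
      linear_combination q * hpn)
    rw [hf, hv', dot_update, dot_update, hq, hzi] at this
    linear_combination this - q * hbk
  exact ⟨b, hba, fun j => by have := hz0 j; simp only [hz] at this; linear_combination this, hbk⟩

lemma caseB2 (C : Ctx π n m f) {s k : ℕ} (hn : n = s + k) (hk : 1 ≤ k) (a1 a' : R)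
    (v0 v' : Fin m → R) (ha : IsUnit a1) (t : ℕ) (ht : 1 ≤ t) (htn : t < n)
    (i : Fin m) (hi : IsUnit (v0 i))
    (H : ∀ x ≠ 0, π ^ s * (π ^ t * a1 * f x + dot v0 x) = 0 → a' * f x + dot v' x = 0) :
    ∃ b, a' = b * (π ^ t * a1) ∧ (∀ j, v' j = b * v0 j) ∧ b * π ^ k = 0 := by
  obtain ⟨d, hd⟩ := hi.exists_right_inv
  have hdu : IsUnit d := IsUnit.of_mul_eq_one _ (by rw [mul_comm]; exact hd)
  obtain ⟨t', rfl⟩ := Nat.exists_eq_add_of_le' ht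
  obtain ⟨k', rfl⟩ := Nat.exists_eq_add_of_le' hk
  obtain ⟨j0, hj0⟩ := C.exj i
  have hpn := C.pn
  rw [hn, pow_add] at hpn
  set b := v' i * d with hb
  have hvi : v' i = b * v0 i := by rw [hb]; linear_combination (-v' i) * hd
  have ha' : a' = b * (π ^ (t'+1) * a1) := by
    have hp0 := C.pn1 _ htn
    have hx : pr i j0 (π ^ (t'+1)) 0 ≠ 0 := pr_ne hj0 (Or.inl hp0)
    have hfu := C.un _ _ _ _ hx
    set F := f (pr i j0 (π ^ (t'+1)) 0) with hF
    have hu : IsUnit (-(a1 * F * d)) := ((ha.mul hfu).mul hdu).neg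
    have hf := C.inv i j0 _ _ _ hx hu
    have := H _ (pr_ne hj0 (Or.inl (fun h => hp0 ((hu.mul_right_eq_zero).1 h)))) (by
      rw [hf, dot_pr, ← hF]
      linear_combination (-π ^ s * π ^ (t'+1) * a1 * F) * hd)
    rw [hf, dot_pr, ← hF, hvi] at this
    have h0 : F * (a' - b * (π ^ (t'+1) * a1)) = 0 := by
      linear_combination this + b * (π ^ (t'+1) * a1 * F) * hd
    linear_combination (hfu.mul_right_eq_zero).1 h0
  have key : ∀ j, j ≠ i → ∀ q, π ^ s * (π ^ (k'+1) * q) = 0 →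
      b * v0 i * (π ^ (k'+1) * q) + (v' j - b * v0 j) = 0 := by
    intro j hj q hq
    set F := f (pr i j (-(v0 j * d)) 1) with hF
    have hf : f (pr i j (-(v0 j * d) - π ^ (t'+1) * a1 * F * d + π ^ (k'+1) * q) 1) = F :=
      C.cg i j _ _ hj ⟨- π ^ t' * a1 * F * d + π ^ k' * q, by ring⟩
    have := H _ (pr_ne hj (Or.inr one_ne_zero)) (by
      rw [hf, dot_pr]
      linear_combination v0 i * hq - (π ^ s) * (v0 j + π ^ (t'+1) * a1 * F) * hd)
    rw [hf, dot_pr, hvi, ha'] at this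
    linear_combination this + b * (v0 j + π ^ (t'+1) * a1 * F) * hd
  have hz : ∀ j, j ≠ i → v' j = b * v0 j := fun j hj => by
    have := key j hj 0 (by simp)
    linear_combination this
  refine ⟨b, ha', fun j => ?_, ?_⟩
  · by_cases hj : j = i
    · rw [hj, hvi]
    · exact hz j hj
  · have := key j0 hj0 1 (by linear_combination hpn)
    have h0 : v0 i * (b * π ^ (k'+1)) = 0 := by linear_combination this - hz j0 hj0
    exact (hi.mul_right_eq_zero).1 h0

lemma Ctx.main (C : Ctx π n m f) (a a' : R) (v v' : Fin m → R) (hne : a ≠ 0 ∨ v ≠ 0)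
    (H : ∀ x ≠ 0, a * f x + dot v x = 0 → a' * f x + dot v' x = 0) :
    ∃ b, a' = b * a ∧ ∀ j, v' j = b * v j := by
  have split : ∀ {s : ℕ} {w u : R}, w = π ^ s * u → w ≠ 0 → ∃ k, n = s + k ∧ 1 ≤ k := by
    intro s w u h h0
    have : s < n := C.plt (fun hs => h0 (by rw [h, hs, zero_mul]))
    exact ⟨n - s, by omega, by omega⟩
  have fin : ∀ {s k : ℕ} {a0 : R} {v0 : Fin m → R}, n = s + k → a = π ^ s * a0 →
      (∀ j, v j = π ^ s * v0 j) →
      (∃ b, a' = b * a0 ∧ (∀ j, v' j = b * v0 j) ∧ b * π ^ k = 0) →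
      ∃ b, a' = b * a ∧ ∀ j, v' j = b * v j := by
    rintro s k a0 v0 hn h1 h2 ⟨b, e1, e2, e3⟩
    obtain ⟨b', rfl⟩ := C.ann hn e3
    exact ⟨b', by rw [e1, h1]; ring, fun j => by rw [e2, h2]; ring⟩
  have dv : ∀ {s : ℕ} {v0 : Fin m → R}, (∀ j, v j = π ^ s * v0 j) → ∀ x,
      dot v x = π ^ s * dot v0 x := by
    intro s v0 h x
    rw [dot_lin_l v0 0 v (π ^ s) 0 (fun j => by simp [h]) x]; simp
  by_cases ha : a = 0
  · have hv : v ≠ 0 := by tauto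
    obtain ⟨s, v0, hv0, i, hi⟩ := C.decomp v hv
    obtain ⟨j, hj⟩ := Function.ne_iff.1 hv
    obtain ⟨k, hn, hk⟩ := split (hv0 j) hj
    obtain ⟨e1, b, e2, e3⟩ := caseA C hn v0 v' a' i hi (fun x hx h => H x hx (by
      rw [ha, dv hv0, h]; simp))
    exact fin (a0 := 0) hn (by simp [ha]) hv0 ⟨b, by simp [e1], e2, e3⟩
  obtain ⟨s, w0, hw0, hu⟩ := C.decomp (fun o : Option (Fin m) => o.elim a v)
    (fun h => ha (congrFun h none))
  set a0 := w0 none with ha0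
  set v0 : Fin m → R := fun j => w0 (some j) with hv0'
  have hsa : a = π ^ s * a0 := hw0 none
  have hsv : ∀ j, v j = π ^ s * v0 j := fun j => hw0 (some j)
  obtain ⟨k, hn, hk⟩ := split hsa ha
  have H0 : ∀ x ≠ 0, π ^ s * (a0 * f x + dot v0 x) = 0 → a' * f x + dot v' x = 0 :=
    fun x hx h => H x hx (by rw [dv hsv, hsa, ← h]; ring)
  by_cases hau : IsUnit a0
  · by_cases hv : v = 0
    · obtain ⟨e1, b, e2, e3⟩ := caseB1a C hn hk a0 a' v' hau (fun x hx h => H x hx (by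
        rw [hsa, hv]; simp [dot]; linear_combination h))
      exact fin (v0 := 0) hn hsa (by simp [hv]) ⟨b, e2, by simp [e1], e3⟩
    obtain ⟨j, hj⟩ := Function.ne_iff.1 hv
    obtain ⟨r, y, hy, i, hi⟩ := C.decomp v0 (by
      intro h; apply hj; rw [hsv, h]; simp)
    have hrk : s + r < n := C.plt (fun h => hj (by
      rw [hsv, hy, ← mul_assoc, ← pow_add, h]; simp))
    rcases Nat.eq_zero_or_pos r with rfl | hr
    · exact fin hn hsa hsv (caseB1b C hn hk a0 a' v0 v' hau i (by rw [hy]; simpa using hi) H0)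
    · obtain ⟨b, e1, e2, e3⟩ := caseB1c C hn a0 a' y v' hau i hi r hr (by omega)
        (fun x hx h => H0 x hx (by
          rw [← h, dot_lin_l y 0 v0 (π ^ r) 0 (fun j => by simp [hy]) x]; simp))
      exact fin hn hsa hsv ⟨b, e1, fun j => by rw [e2, hy], e3⟩
  · obtain ⟨o, ho⟩ := hu
    have : ∃ i, IsUnit (v0 i) := by
      cases o with
      | none => exact absurd ho hau
      | some i => exact ⟨i, ho⟩
    obtain ⟨i, hi⟩ := this
    have ha00 : a0 ≠ 0 := fun h => ha (by rw [hsa, h, mul_zero])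
    obtain ⟨t, w, hw, ⟨⟩, hwu⟩ := C.decomp (fun _ : Unit => a0) (fun h => ha00 (congrFun h ()))
    have hw : a0 = π ^ t * w () := hw ()
    have ht : 1 ≤ t := by
      by_contra h
      have : t = 0 := by omega
      subst this
      exact hau (by rw [hw]; simpa using hwu)
    have htn : t < n := C.plt (fun h => ha00 (by rw [hw, h, zero_mul]))
    have := caseB2 C hn hk (w ()) a' v0 v' hwu t ht htn i hi (fun x hx h => H0 x hx (by
      rw [hw]; exact h))
    rw [← hw] at this
    exact fin hn hsa hsv this

end

theorem stmt_17
    (R : Type) [CommRing R] [IsLocalRing R] [Fintype R]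
    (p n ℓ : ℕ) (hp : p.Prime) (hn : 1 ≤ n)
    (hmax : IsLocalRing.maximalIdeal R = Ideal.span {(p : R)})
    (hpn : (p : R) ^ n = 0) (hpn1 : (p : R) ^ (n - 1) ≠ 0)
    (hres : Nat.card (IsLocalRing.ResidueField R) = p ^ ℓ)
    (hq : 3 < p ^ ℓ) (m : ℕ) (hm : 3 ≤ m) (f : (Fin m → R) → R)
    (h1 : ∀ x : Fin m → R, 1 ≤ wt x → wt x ≤ 2 →
      (∀ u : Rˣ, f ((u : R) • x) = f x) ∧ IsUnit (f x))
    (h2 : ∀ x x' : Fin m → R, (∀ r : R, r ≠ 0 → r • x ≠ 0) → (∀ r : R, r ≠ 0 → r • x' ≠ 0) →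
      1 ≤ wt x → wt x ≤ 2 → 1 ≤ wt x' → wt x' ≤ 2 →
      (∃ y : Fin m → R, x - x' = (p : R) • y) → f x = f x')
    (h3 : ∀ x : Fin m → R, wt x = m →
      (∃ j k : Fin m, j ≠ k ∧ IsUnit (x j) ∧ IsUnit (x k)) → f x = 0)
    (h4 : ∀ x : Fin m → R, ∀ r : ℕ, wt x = m → 1 ≤ r → r ≤ n - 1 →
      (∃ j₀ : Fin m, IsUnit (x j₀) ∧ ∀ j, j ≠ j₀ → ∃ u : Rˣ, x j = (p : R) ^ r * (u : R)) →
      f x = (p : R) ^ r) :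
    IsMinimalCode (Cf f) := by
  have hnu : ¬ IsUnit (p : R) := by
    have : (p : R) ∈ IsLocalRing.maximalIdeal R := by
      rw [hmax]; exact Ideal.mem_span_singleton_self _
    exact this
  have hdv : ∀ x : R, ¬ IsUnit x → (p : R) ∣ x := by
    intro x hx
    have : x ∈ IsLocalRing.maximalIdeal R := hx
    rw [hmax] at this
    exact Ideal.mem_span_singleton.1 this
  have root : ∀ (x : Fin m → R) i, IsUnit (x i) → ∀ r : R, r ≠ 0 → r • x ≠ 0 := by
    intro x i hi r hr h
    have := congrFun h i
    simp only [Pi.smul_apply, smul_eq_mul, Pi.zero_apply] at this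
    exact hr ((hi.mul_left_eq_zero).1 this)
  have C : Ctx (p : R) n m f := by
    refine ⟨hm, hpn, ?_, hnu, hdv, ?_, ?_, ?_, ?_, ?_, ?_⟩
    · intro k hk h
      exact hpn1 (pow_eq_zero_of_le (by omega) h)
    · classical
      haveI : Finite (IsLocalRing.ResidueField R) :=
        Finite.of_surjective _ IsLocalRing.residue_surjective
      haveI := Fintype.ofFinite (IsLocalRing.ResidueField R)
      have hc : ({0, 1} : Finset (IsLocalRing.ResidueField R)).card < Fintype.card (IsLocalRing.ResidueField R) := by
        rw [← Nat.card_eq_fintype_card, hres]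
        exact lt_of_le_of_lt Finset.card_le_two (by omega)
      obtain ⟨e, he⟩ : ∃ e, e ∉ ({0, 1} : Finset (IsLocalRing.ResidueField R)) := by
        by_contra hcon
        push Not at hcon
        rw [Finset.eq_univ_iff_forall.2 hcon, Finset.card_univ] at hc
        exact lt_irrefl _ hc
      obtain ⟨e, rfl⟩ := IsLocalRing.residue_surjective e
      simp only [Finset.mem_insert, Finset.mem_singleton, not_or] at he
      refine ⟨e, ?_, ?_⟩
      · exact (IsLocalRing.residue_ne_zero_iff_isUnit _).1 he.1
      · refine (IsLocalRing.residue_ne_zero_iff_isUnit _).1 ?_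
        rw [map_sub, map_one]
        exact sub_ne_zero.2 he.2
    · intro i j c d e hx he
      obtain ⟨l, hl⟩ := Function.ne_iff.1 hx
      have := (h1 _ (wt_pos _ l hl) (wt_pr i j c d)).1 he.unit
      rwa [IsUnit.unit_spec, smul_pr] at this
    · intro i j c d hx
      obtain ⟨l, hl⟩ := Function.ne_iff.1 hx
      exact (h1 _ (wt_pos _ l hl) (wt_pr i j c d)).2
    · intro i j b b' hj hb
      obtain ⟨q, hq⟩ := hb
      have u1 : IsUnit (pr i j b 1 j) := by rw [pr_right hj]; exact isUnit_one
      have u2 : IsUnit (pr i j b' 1 j) := by rw [pr_right hj]; exact isUnit_one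
      refine h2 _ _ (root _ j u1) (root _ j u2) (wt_pos _ j u1.ne_zero) (wt_pr _ _ _ _)
        (wt_pos _ j u2.ne_zero) (wt_pr _ _ _ _) ⟨Pi.single i q, ?_⟩
      funext l
      simp only [pr, Pi.sub_apply, Pi.add_apply, Pi.smul_apply, Pi.single_apply, smul_eq_mul]
      split_ifs <;> first | linear_combination hq | ring
    · intro x hx i hu
      apply h3 x (wt_full x hx)
      obtain ⟨j, hj⟩ : ∃ j : Fin m, j ∉ ({i} : Finset (Fin m)) := by
        by_contra hcon
        push Not at hcon
        have := congrArg Finset.card (Finset.eq_univ_iff_forall.2 hcon)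
        rw [Finset.card_univ, Fintype.card_fin] at this
        simp at this
        omega
      obtain ⟨k, hk⟩ : ∃ k : Fin m, k ∉ ({i, j} : Finset (Fin m)) := by
        by_contra hcon
        push Not at hcon
        have := congrArg Finset.card (Finset.eq_univ_iff_forall.2 hcon)
        rw [Finset.card_univ, Fintype.card_fin] at this
        have h2 : ({i, j} : Finset (Fin m)).card ≤ 2 := Finset.card_le_two
        omega
      simp only [Finset.mem_insert, Finset.mem_singleton, not_or] at hj hk
      exact ⟨j, k, Ne.symm hk.2, hu j hj, hu k hk.1⟩
    · intro x r hr hrn i hi hu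
      have hpr : (p : R) ^ r ≠ 0 := fun h => hpn1 (pow_eq_zero_of_le (by omega) h)
      refine h4 x r (wt_full x fun l => ?_) hr (by omega) ⟨i, hi, fun j hj => ?_⟩
      · by_cases hl : l = i
        · rw [hl]; exact hi.ne_zero
        · obtain ⟨u, hu', h⟩ := hu l hl
          rw [h]
          exact fun h0 => hpr ((hu'.mul_left_eq_zero).1 h0)
      · obtain ⟨u, hu', h⟩ := hu j hj
        exact ⟨hu'.unit, by rw [h, IsUnit.unit_spec]⟩
  rintro c ⟨a, v, rfl⟩ hc
  refine ⟨hc, ?_⟩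
  rintro c' ⟨a', v', rfl⟩ hs
  have hne : a ≠ 0 ∨ v ≠ 0 := by
    by_contra h
    push Not at h
    apply hc
    funext x
    simp [cword, h.1, h.2, dot]
  obtain ⟨b, hb1, hb2⟩ := C.main a a' v v' hne (fun x hx h => by
    by_contra h0
    exact hs ⟨x, hx⟩ h0 h)
  refine ⟨b, ?_⟩
  funext x
  simp only [cword, Pi.smul_apply, smul_eq_mul]
  rw [hb1, dot_lin_l v 0 v' b 0 (fun j => by simp [hb2]) x.1]
  ring
end

section
/- Let t ≥ 2 and m ≥ 1, let a_1, …, a_t be units of R, and let g_1, …, g_t be monomials g_i(x) = ∏_{j=1}^m x_j^{b_{ij}} with exponents b_{ij} ∈ ℕ; write s(g_i) = {j : b_{ij} ≠ 0}. Assume that for every 1 ≤ i ≤ t: (1) there exists an index j with b_{ij} = 1; (2) the sets s(g_1), …, s(g_t) are pairwise disjoint; (3) |s(g_i)| ≥ 3. Define f : R^m → R by f(x) = Σ_{i=1}^t a_i·g_i(x). Then C_f is a minimal linear code, i.e., every nonzero codeword of C_f is a minimal codeword. -/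
lemma dot_single_r {R : Type*} [CommRing R] {m : ℕ} (v : Fin m → R) (j : Fin m) (y : R) :
    dot v (Pi.single j y) = v j * y := by
  simp [dot, Pi.single_apply]

/-- Extracting the maximal power of `p` from a family. -/
lemma exists_content {R : Type*} [CommRing R] [IsLocalRing R] (p : R)
    (hmax : IsLocalRing.maximalIdeal R = Ideal.span {p}) {ι : Type*} (w : ι → R) (k : ℕ) :
    (∃ w0 : ι → R, ∀ j, w j = p ^ k * w0 j) ∨
      ∃ r < k, ∃ w0 : ι → R, (∀ j, w j = p ^ r * w0 j) ∧ ∃ j, IsUnit (w0 j) := by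
  induction k with
  | zero => exact Or.inl ⟨w, by simp⟩
  | succ k ih =>
    rcases ih with ⟨w0, h⟩ | ⟨r, hr, h⟩
    · by_cases hu : ∃ j, IsUnit (w0 j)
      · exact Or.inr ⟨k, by omega, w0, h, hu⟩
      · push Not at hu
        have : ∀ j, ∃ c, w0 j = p * c := by
          intro j
          have : w0 j ∈ IsLocalRing.maximalIdeal R := (IsLocalRing.mem_maximalIdeal _).2 (hu j)
          rw [hmax, Ideal.mem_span_singleton] at this
          exact this
        choose c hc using this
        exact Or.inl ⟨c, fun j => by rw [h, hc]; ring⟩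
    · exact Or.inr ⟨r, by omega, h⟩

lemma ann_pow {R : Type*} [CommRing R] [IsLocalRing R] (p : R)
    (hmax : IsLocalRing.maximalIdeal R = Ideal.span {p}) (n r : ℕ) (hr : r < n)
    (hpn : p ^ n = 0) (hpn1 : p ^ (n - 1) ≠ 0) (y : R) (hy : y * p ^ (n - r) = 0) :
    ∃ c, y = p ^ r * c := by
  rcases exists_content p hmax (fun _ : Unit => y) n with ⟨w0, h⟩ | ⟨s, hs, w0, h, ⟨j, hu⟩⟩
  · exact ⟨0, by rw [h (), hpn]; ring⟩
  · have h' := h j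
    have h0 : p ^ (s + (n - r)) = 0 := by
      rw [h'] at hy
      have : w0 j * p ^ (s + (n - r)) = 0 := by rw [pow_add, ← hy]; ring
      exact (hu.mul_right_eq_zero).1 this
    have hsr : r ≤ s := by
      by_contra hlt
      apply hpn1
      rw [show n - 1 = (s + (n - r)) + (n - 1 - (s + (n - r))) by omega, pow_add, h0, zero_mul]
    exact ⟨p ^ (s - r) * w0 j, by rw [h', ← mul_assoc, ← pow_add]; congr 2; omega⟩

lemma f_small {R : Type*} [CommRing R] {t m : ℕ} (a : Fin t → R) (b : Fin t → Fin m → ℕ)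
    (h3 : ∀ i, 3 ≤ {j : Fin m | b i j ≠ 0}.ncard) (j j' : Fin m) (x : Fin m → R)
    (hx : ∀ k, k ≠ j → k ≠ j' → x k = 0) :
    ∑ i, a i * ∏ k, x k ^ b i k = 0 := by
  apply Finset.sum_eq_zero
  intro i _
  have : ∃ k, b i k ≠ 0 ∧ k ≠ j ∧ k ≠ j' := by
    by_contra hcon
    push Not at hcon
    have hsub : {k : Fin m | b i k ≠ 0} ⊆ ({j, j'} : Set (Fin m)) := by
      intro k hk
      by_cases hkj : k = j
      · simp [hkj]
      · simp [hcon k hk hkj]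
    have h4 := Set.ncard_le_ncard hsub (Set.toFinite _)
    have h5 : ({j, j'} : Set (Fin m)).ncard ≤ 2 := (Set.ncard_insert_le j {j'}).trans (by rw [Set.ncard_singleton])
    have := h3 i
    omega
  obtain ⟨k, hk, h1, h2⟩ := this
  rw [Finset.prod_eq_zero (Finset.mem_univ k), mul_zero]
  rw [hx k h1 h2, zero_pow hk]

lemma f_key {R : Type*} [CommRing R] {t m : ℕ} (a : Fin t → R) (b : Fin t → Fin m → ℕ)
    (h2 : ∀ i i' : Fin t, i ≠ i' → ∀ j, b i j ≠ 0 → b i' j ≠ 0 → False)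
    (h3 : ∀ i, 3 ≤ {j : Fin m | b i j ≠ 0}.ncard) (i : Fin t) (l j : Fin m)
    (hl : b i l = 1) (hj : b i j = 0) :
    ∃ x0 : Fin m → R, ∀ y z : R,
      ∑ i', a i' * ∏ k, (x0 + Pi.single l y + Pi.single j z : Fin m → R) k ^ b i' k = a i * y := by
  have hlj : l ≠ j := by rintro rfl; omega
  refine ⟨fun k => if k = l then 0 else if b i k ≠ 0 then 1 else 0, fun y z => ?_⟩
  rw [Finset.sum_eq_single i]
  · congr 1
    rw [Finset.prod_eq_single l]
    · simp [hl, Pi.single_apply, hlj]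
    · intro k _ hk
      by_cases hb : b i k = 0
      · simp [hb]
      · have hkj : k ≠ j := by rintro rfl; exact hb hj
        simp [Pi.single_apply, hk, hkj, hb]
    · simp
  · intro i' _ hi'
    have : ∃ k, b i' k ≠ 0 ∧ k ≠ j := by
      by_contra hcon
      push Not at hcon
      have hsub : {k : Fin m | b i' k ≠ 0} ⊆ ({j} : Set (Fin m)) := fun k hk => hcon k hk
      have h4 := Set.ncard_le_ncard hsub (Set.toFinite _)
      rw [Set.ncard_singleton] at h4
      have := h3 i'
      omega
    obtain ⟨k, hk, hkj⟩ := this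
    have hb : b i k = 0 := by
      by_contra hb
      exact h2 i' i hi' k hk hb
    have hkl : k ≠ l := by rintro rfl; omega
    rw [Finset.prod_eq_zero (Finset.mem_univ k), mul_zero]
    simp [Pi.single_apply, hkl, hkj, hb, hk]
  · simp

/-- The core statement in terms of coefficient pairs. -/
lemma core {R : Type*} [CommRing R] [IsLocalRing R] (p : R)
    (hmax : IsLocalRing.maximalIdeal R = Ideal.span {p}) (n : ℕ)
    (hpn : p ^ n = 0) (hpn1 : p ^ (n - 1) ≠ 0)
    {t m : ℕ} (ht : 2 ≤ t) (a : Fin t → R) (ha : ∀ i, IsUnit (a i))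
    (b : Fin t → Fin m → ℕ)
    (h1 : ∀ i, ∃ j, b i j = 1)
    (h2 : ∀ i i' : Fin t, i ≠ i' → ∀ j, b i j ≠ 0 → b i' j ≠ 0 → False)
    (f : (Fin m → R) → R)
    (hsmall : ∀ j j' y z, f (Pi.single j y + Pi.single j' z) = 0)
    (hkey : ∀ i l j, b i l = 1 → b i j = 0 →
      ∃ x0 : Fin m → R, ∀ y z : R, f (x0 + Pi.single l y + Pi.single j z) = a i * y)
    (r : ℕ) (hr : r < n) (A : R) (v : Fin m → R) (hu : IsUnit A ∨ ∃ j, IsUnit (v j))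
    (B : R) (w : Fin m → R)
    (H : ∀ x c, A * f x + dot v x = p ^ (n - r) * c → B * f x + dot w x = 0) :
    ∃ d, B = d * (p ^ r * A) ∧ ∀ j, w j = d * (p ^ r * v j) := by
  have hout : ∀ j, ∃ i, b i j = 0 := by
    intro j
    by_contra hcon
    push Not at hcon
    exact h2 ⟨0, by omega⟩ ⟨1, by omega⟩ (by simp) j (hcon _) (hcon _)
  by_cases hv : ∃ j, IsUnit (v j)
  · obtain ⟨j0, hj0⟩ := hv
    obtain ⟨u, hu'⟩ := hj0.exists_right_inv
    have hcross : ∀ j, w j * v j0 = w j0 * v j := by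
      intro j
      have := H (Pi.single j (v j0) + Pi.single j0 (- v j)) 0 (by
        rw [hsmall, dot_add_r, dot_single_r, dot_single_r]; ring)
      rw [hsmall, dot_add_r, dot_single_r, dot_single_r] at this
      linear_combination this
    have hann : w j0 * p ^ (n - r) = 0 := by
      have := H (Pi.single j0 (p ^ (n - r)) + Pi.single j0 0) (v j0) (by
        rw [hsmall, dot_add_r, dot_single_r, dot_single_r]; ring)
      rw [hsmall, dot_add_r, dot_single_r, dot_single_r] at this
      linear_combination this
    obtain ⟨c, hc⟩ := ann_pow p hmax n r hr hpn hpn1 _ hann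
    have hw : ∀ j, w j = (c * u) * (p ^ r * v j) := by
      intro j
      linear_combination (-w j) * hu' + u * hcross j + u * v j * hc
    refine ⟨c * u, ?_, hw⟩
    obtain ⟨i, hi⟩ := hout j0
    obtain ⟨l, hl⟩ := h1 i
    obtain ⟨x0, hx0⟩ := hkey i l j0 hl hi
    obtain ⟨z, hz⟩ : ∃ z, z = -u * (A * a i + dot v (x0 + Pi.single l 1)) := ⟨_, rfl⟩
    have hzero : A * f (x0 + Pi.single l 1 + Pi.single j0 z)
        + dot v (x0 + Pi.single l 1 + Pi.single j0 z) = 0 := by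
      rw [hx0, dot_add_r _ (x0 + _), dot_single_r, hz]
      linear_combination (-(A * a i + dot v (x0 + Pi.single l 1))) * hu'
    have hB := H _ 0 (by rw [hzero, mul_zero])
    have hdw : ∀ x, dot w x = (c * u) * (p ^ r * dot v x) := by
      intro x
      simp only [dot, Finset.mul_sum]
      exact Finset.sum_congr rfl fun k _ => by rw [hw]; ring
    rw [hdw] at hB
    have hfin : (B - c * u * (p ^ r * A)) * a i = 0 := by
      rw [hx0] at hB hzero
      linear_combination hB - c * u * p ^ r * hzero
    have := ((ha i).mul_left_eq_zero).1 hfin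
    linear_combination this
  · have hA : IsUnit A := hu.resolve_right hv
    push Not at hv
    obtain ⟨A', hA'⟩ := hA.exists_right_inv
    have hvp : ∀ j, v j ∈ IsLocalRing.maximalIdeal R := fun j =>
      (IsLocalRing.mem_maximalIdeal _).2 (hv j)
    have hunit : ∀ i l, IsUnit (A * a i + v l) := by
      intro i l
      by_contra hcon
      have h5 : A * a i + v l ∈ IsLocalRing.maximalIdeal R :=
        (IsLocalRing.mem_maximalIdeal _).2 hcon
      have h6 := (Ideal.add_mem_iff_left _ (hvp l)).1 h5
      exact (IsLocalRing.mem_maximalIdeal _).1 h6 (hA.mul (ha i))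
    -- the reduced vector
    obtain ⟨w', hw'⟩ : ∃ w' : Fin m → R, ∀ j, w' j = w j - B * A' * v j := ⟨_, fun _ => rfl⟩
    have hdw : ∀ x, dot w x = dot w' x + B * A' * dot v x := by
      intro x
      simp only [dot, Finset.mul_sum, ← Finset.sum_add_distrib]
      exact Finset.sum_congr rfl fun k _ => by rw [hw']; ring
    have H' : ∀ x, A * f x + dot v x = 0 → dot w' x = 0 := by
      intro x hx
      have := H x 0 (by rw [hx, mul_zero])
      rw [hdw] at this
      linear_combination this - B * A' * hx + B * f x * hA'
    have hrel : ∀ i l j, b i l = 1 → b i j = 0 → ∃ q ∈ IsLocalRing.maximalIdeal R,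
        w' j = q * w' l := by
      intro i l j hl hj
      obtain ⟨x0, hx0⟩ := hkey i l j hl hj
      obtain ⟨u, hu'⟩ := (hunit i l).exists_right_inv
      have hz : ∀ z, dot w' x0 + w' l * (-u * (dot v x0 + v j * z)) + w' j * z = 0 := by
        intro z
        have := H' (x0 + Pi.single l (-u * (dot v x0 + v j * z)) + Pi.single j z) (by
          rw [hx0, dot_add_r, dot_add_r, dot_single_r, dot_single_r]
          linear_combination (-(dot v x0 + v j * z)) * hu')
        rw [dot_add_r, dot_add_r, dot_single_r, dot_single_r] at this
        exact this
      refine ⟨u * v j, Ideal.mul_mem_left _ _ (hvp j), ?_⟩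
      linear_combination hz 1 - hz 0
    have hone : ∀ i l, b i l = 1 → w' l = 0 := by
      intro i l hl
      obtain ⟨i', hi'⟩ := hout l
      have hne : i ≠ i' := by rintro rfl; omega
      obtain ⟨l', hl'⟩ := h1 i'
      have hb : b i l' = 0 := by
        by_contra hb
        exact h2 i i' hne l' hb (by omega)
      obtain ⟨q, hq, e1⟩ := hrel i l l' hl hb
      obtain ⟨q', hq', e2⟩ := hrel i' l' l hl' hi'
      have hun : IsUnit (1 - q' * q) := by
        by_contra hcon
        have h5 : 1 - q' * q ∈ IsLocalRing.maximalIdeal R :=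
          (IsLocalRing.mem_maximalIdeal _).2 hcon
        have h6 := Ideal.add_mem _ h5 (Ideal.mul_mem_left _ q' hq)
        rw [sub_add_cancel] at h6
        exact (IsLocalRing.mem_maximalIdeal _).1 h6 isUnit_one
      apply (hun.mul_right_eq_zero).1
      linear_combination e2 + q' * e1
    have hall : ∀ j, w' j = 0 := by
      intro j
      obtain ⟨i, hi⟩ := hout j
      obtain ⟨l, hl⟩ := h1 i
      obtain ⟨q, _, e⟩ := hrel i l j hl hi
      rw [e, hone i l hl, mul_zero]
    have hann : B * p ^ (n - r) = 0 := by
      have i : Fin t := ⟨0, by omega⟩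
      obtain ⟨l, hl⟩ := h1 i
      have hb : ∃ j, b i j = 0 := by
        obtain ⟨i', hi'⟩ := hout l
        have hne : i ≠ i' := by rintro rfl; omega
        obtain ⟨l', hl'⟩ := h1 i'
        refine ⟨l', ?_⟩
        by_contra hb
        exact h2 i i' hne l' hb (by omega)
      obtain ⟨j, hj⟩ := hb
      obtain ⟨x0, hx0⟩ := hkey i l j hl hj
      obtain ⟨u, hu'⟩ := (hunit i l).exists_right_inv
      obtain ⟨y, hy⟩ : ∃ y, y = u * (p ^ (n - r) - dot v x0) := ⟨_, rfl⟩
      have e : A * f (x0 + Pi.single l y + Pi.single j 0)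
          + dot v (x0 + Pi.single l y + Pi.single j 0) = p ^ (n - r) := by
        rw [hx0, dot_add_r, dot_add_r, dot_single_r, dot_single_r, hy]
        linear_combination (p ^ (n - r) - dot v x0) * hu'
      have e2 := H _ 1 (by rw [e, mul_one])
      have hw0 : ∀ x, dot w' x = 0 := fun x => by simp [dot, hall]
      rw [hdw, hw0] at e2
      have e3 : B * A' * p ^ (n - r) = 0 := by
        linear_combination e2 - B * A' * e + B * f (x0 + Pi.single l y + Pi.single j 0) * hA'
      linear_combination A * e3 - B * p ^ (n - r) * hA'
    obtain ⟨c, hc⟩ := ann_pow p hmax n r hr hpn hpn1 _ hann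
    refine ⟨c * A', ?_, fun j => ?_⟩
    · linear_combination hc - p ^ r * c * hA'
    · have := hall j
      rw [hw'] at this
      linear_combination this + A' * v j * hc

theorem stmt_19
    (R : Type) [CommRing R] [IsLocalRing R] [Fintype R]
    (p n ℓ : ℕ) (hp : p.Prime) (hn : 1 ≤ n)
    (hmax : IsLocalRing.maximalIdeal R = Ideal.span {(p : R)})
    (hpn : (p : R) ^ n = 0) (hpn1 : (p : R) ^ (n - 1) ≠ 0)
    (hres : Nat.card (IsLocalRing.ResidueField R) = p ^ ℓ)
    (t m : ℕ) (ht : 2 ≤ t) (hm : 1 ≤ m)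
    (a : Fin t → R) (ha : ∀ i, IsUnit (a i))
    (b : Fin t → Fin m → ℕ)
    (h1 : ∀ i, ∃ j, b i j = 1)
    (h2 : ∀ i i' : Fin t, i ≠ i' → {j : Fin m | b i j ≠ 0} ∩ {j : Fin m | b i' j ≠ 0} = ∅)
    (h3 : ∀ i, 3 ≤ {j : Fin m | b i j ≠ 0}.ncard)
    (f : (Fin m → R) → R) (hf : f = fun x => ∑ i, a i * ∏ j, x j ^ b i j) :
    IsMinimalCode (Cf f) := by
  rintro _ ⟨A, v, rfl⟩ hne
  refine ⟨hne, ?_⟩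
  rintro _ ⟨B, w, rfl⟩ hsupp
  have h2' : ∀ i i' : Fin t, i ≠ i' → ∀ j, b i j ≠ 0 → b i' j ≠ 0 → False := by
    intro i i' hi j hj hj'
    have : j ∈ {j : Fin m | b i j ≠ 0} ∩ {j : Fin m | b i' j ≠ 0} := ⟨hj, hj'⟩
    rw [h2 i i' hi] at this
    exact this
  have hsmall : ∀ j j' y z, f (Pi.single j y + Pi.single j' z) = 0 := by
    intro j j' y z
    rw [hf]
    refine f_small a b h3 j j' _ ?_
    intro k hk hk'
    simp [Pi.single_apply, hk, hk']
  have hkey : ∀ i l j, b i l = 1 → b i j = 0 →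
      ∃ x0 : Fin m → R, ∀ y z : R, f (x0 + Pi.single l y + Pi.single j z) = a i * y := by
    intro i l j hl hj
    rw [hf]
    exact f_key a b h2' h3 i l j hl hj
  have hf0 : f 0 = 0 := by
    have := hsmall ⟨0, hm⟩ ⟨0, hm⟩ 0 0
    simpa using this
  have hd0 : ∀ u : Fin m → R, dot u 0 = 0 := fun u => by simp [dot]
  rcases exists_content (p : R) hmax (fun o : Option (Fin m) => o.elim A v) n with
    ⟨w0, h⟩ | ⟨r, hr, w0, h, hu⟩
  · exfalso
    apply hne
    have hA : A = 0 := by have := h none; simpa [hpn] using this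
    have hv : ∀ j, v j = 0 := fun j => by have := h (some j); simpa [hpn] using this
    funext x
    simp [cword, dot, hA, hv]
  · have hA : A = (p : R) ^ r * w0 none := h none
    have hv : ∀ j, v j = (p : R) ^ r * w0 (some j) := fun j => h (some j)
    have hdv : ∀ x, dot v x = (p : R) ^ r * dot (fun j => w0 (some j)) x := by
      intro x
      simp only [dot, Finset.mul_sum]
      exact Finset.sum_congr rfl fun k _ => by rw [hv]; ring
    obtain ⟨d, hd1, hd2⟩ := core (p : R) hmax n hpn hpn1 ht a ha b h1 h2' f hsmall hkey r hr
      (w0 none) (fun j => w0 (some j)) (by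
        obtain ⟨o, ho⟩ := hu
        cases o with
        | none => exact Or.inl ho
        | some j => exact Or.inr ⟨j, ho⟩) B w (by
        intro x c hx
        by_cases hx0 : x = 0
        · rw [hx0, hf0, hd0]; ring
        · by_contra hcon
          apply hsupp ⟨x, hx0⟩ hcon
          have e : (p : R) ^ r * (p : R) ^ (n - r) = 0 := by
            rw [← pow_add, show r + (n - r) = n by omega, hpn]
          simp only [cword]
          rw [hdv, hA]
          linear_combination (p : R) ^ r * hx + c * e)
    refine ⟨d, ?_⟩
    funext x
    have hdw : dot w x.1 = d * dot v x.1 := by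
      simp only [dot, Finset.mul_sum]
      exact Finset.sum_congr rfl fun k _ => by rw [hd2, hv]; ring
    simp only [cword, Pi.smul_apply, smul_eq_mul]
    rw [hdw, hd1, ← hA]
    ring
end
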